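/- arXiv:2306.01214 — 9 statements merged into one kernel-verified Lean document; each statement's English description precedes it below -/
import Mathlib

section
/- Let u⋆ ∈ U and p⋆ ∈ C*, let γ > 0, and suppose Θ is τ-Lipschitz on ℝⁿ for some τ > 0. Define L(u, p) = ⟨G(u⋆), u⟩ + J(u) + ⟨p, Θ(u)⟩ and L^γ(u, p) = ⟨G(u⋆), u⟩ + J(u) + φ(Θ(u), p). Then the following are equivalent: (a) L(u⋆, p) ≤ L(u⋆, p⋆) ≤ L(u, p⋆) for all u ∈ U and all p ∈ C*; (b) L^γ(u⋆, p) ≤ L^γ(u⋆, p⋆) ≤ L^γ(u, p⋆) for all u ∈ U and all p ∈ C*. -/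
open RealInnerProductSpace

theorem inner_sub_sq_norm_div_le {E : Type*} [NormedAddCommGroup E] [InnerProductSpace ℝ E]
    {γ : ℝ} (hγ : 0 < γ) (a b : E) :
    ⟪a, b⟫ - ‖a‖ ^ 2 / (2 * γ) ≤ γ / 2 * ‖b‖ ^ 2 := by
  have h1 := real_inner_le_norm a b
  have h2 : γ / 2 * ‖b‖ ^ 2 - (‖a‖ * ‖b‖ - ‖a‖ ^ 2 / (2 * γ)) =
      (‖a‖ - γ * ‖b‖) ^ 2 / (2 * γ) := by
    field_simp
    ring
  have h3 : 0 ≤ (‖a‖ - γ * ‖b‖) ^ 2 / (2 * γ) := by positivity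
  linarith

theorem inner_sub_sq_norm_sub_div_le {E : Type*} [NormedAddCommGroup E] [InnerProductSpace ℝ E]
    {γ : ℝ} (hγ : 0 < γ) (q p θ : E) :
    ⟪q, θ⟫ - ‖q - p‖ ^ 2 / (2 * γ) ≤ ⟪p, θ⟫ + γ / 2 * ‖θ‖ ^ 2 := by
  have h := inner_sub_sq_norm_div_le hγ (q - p) θ
  rw [inner_sub_left] at h
  linarith

theorem bddAbove_inner_sub_sq_norm_sub_div {E : Type*} [NormedAddCommGroup E]
    [InnerProductSpace ℝ E] {γ : ℝ} (hγ : 0 < γ) (K : Set E) (θ p : E) :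
    BddAbove ((fun q => ⟪q, θ⟫ - ‖q - p‖ ^ 2 / (2 * γ)) '' K) := by
  refine ⟨⟪p, θ⟫ + γ / 2 * ‖θ‖ ^ 2, ?_⟩
  rintro _ ⟨q, -, rfl⟩
  exact inner_sub_sq_norm_sub_div_le hγ q p θ

theorem inner_le_sSup_inner_sub_sq_norm_sub_div {E : Type*} [NormedAddCommGroup E]
    [InnerProductSpace ℝ E] {γ : ℝ} (hγ : 0 < γ) {K : Set E} (θ : E) {p : E} (hp : p ∈ K) :
    ⟪p, θ⟫ ≤ sSup ((fun q => ⟪q, θ⟫ - ‖q - p‖ ^ 2 / (2 * γ)) '' K) :=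
  le_csSup (bddAbove_inner_sub_sq_norm_sub_div hγ K θ p) ⟨p, hp, by simp⟩

theorem inner_nonpos_of_forall_inner_le {E : Type*} [NormedAddCommGroup E]
    [InnerProductSpace ℝ E] {K : Set E} (hK : ∀ p ∈ K, ∀ t : ℝ, 0 ≤ t → t • p ∈ K) {θ : E} {M : ℝ}
    (hM : ∀ p ∈ K, ⟪p, θ⟫ ≤ M) {p : E} (hp : p ∈ K) : ⟪p, θ⟫ ≤ 0 := by
  by_contra! h
  have hM0 : 0 ≤ M := h.le.trans (hM p hp)
  have h1 := hM _ (hK p hp (M / ⟪p, θ⟫ + 1) (by positivity))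
  rw [real_inner_smul_left, add_mul, div_mul_cancel₀ _ h.ne'] at h1
  linarith

theorem inner_eq_zero_of_sSup_nonneg {E : Type*} [NormedAddCommGroup E]
    [InnerProductSpace ℝ E] {γ : ℝ} (hγ : 0 < γ) {K : Set E} {θ p : E}
    (hθ : ∀ q ∈ K, ⟪q, θ⟫ ≤ 0) (hp : p ∈ K)
    (hS : 0 ≤ sSup ((fun q => ⟪q, θ⟫ - ‖q - p‖ ^ 2 / (2 * γ)) '' K)) : ⟪p, θ⟫ = 0 := by
  refine le_antisymm (hθ p hp) ?_
  by_contra! h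
  obtain ⟨a, ha⟩ : ∃ a, a = -⟪p, θ⟫ := ⟨_, rfl⟩
  have ha0 : 0 < a := by linarith
  obtain ⟨l, hl⟩ : ∃ l, l = a / (γ * ‖θ‖ ^ 2 + a) := ⟨_, rfl⟩
  have hl0 : 0 < l := by rw [hl]; positivity
  have hl1 : l * (γ * ‖θ‖ ^ 2) + l * a = a := by rw [hl]; field_simp
  have hle : l ≤ 1 := by
    rw [hl, div_le_one (by positivity)]
    have : 0 ≤ γ * ‖θ‖ ^ 2 := by positivity
    linarith
  have hub : sSup ((fun q => ⟪q, θ⟫ - ‖q - p‖ ^ 2 / (2 * γ)) '' K) ≤ -(l * a / 2) := by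
    refine csSup_le ⟨_, p, hp, rfl⟩ ?_
    rintro _ ⟨q, hq, rfl⟩
    have h1 := inner_sub_sq_norm_div_le hγ (q - p) (l • θ)
    rw [inner_smul_right, inner_sub_left, norm_smul, Real.norm_of_nonneg hl0.le, mul_pow] at h1
    have h2 : ⟪q, θ⟫ ≤ l * ⟪q, θ⟫ := by nlinarith [hθ q hq]
    have h3 : l * (l * (γ * ‖θ‖ ^ 2)) ≤ l * a :=
      mul_le_mul_of_nonneg_left (by nlinarith) hl0.le
    have h4 : l * (⟪q, θ⟫ - ⟪p, θ⟫) = l * ⟪q, θ⟫ + l * a := by rw [ha]; ring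
    have h5 : γ / 2 * (l ^ 2 * ‖θ‖ ^ 2) = l * (l * (γ * ‖θ‖ ^ 2)) / 2 := by ring
    show ⟪q, θ⟫ - ‖q - p‖ ^ 2 / (2 * γ) ≤ _
    linarith
  have : 0 < l * a := by positivity
  linarith

theorem nonneg_of_forall_mul_add_mul_sq_nonneg {D K : ℝ}
    (h : ∀ t : ℝ, 0 < t → t ≤ 1 → 0 ≤ t * D + K * t ^ 2) : 0 ≤ D := by
  by_contra! hD
  obtain ⟨t, ht⟩ : ∃ t, t = -D / (|K| + -D) := ⟨_, rfl⟩
  have hpos : 0 < |K| + -D := by linarith [abs_nonneg K]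
  have ht0 : 0 < t := by rw [ht]; exact div_pos (by linarith) hpos
  have ht1 : t ≤ 1 := by
    rw [ht, div_le_one hpos]
    linarith [abs_nonneg K]
  have hteq : t * (|K| + -D) = -D := by rw [ht]; field_simp
  have h1 : 0 ≤ t * (D + K * t) := by linarith [h t ht0 ht1]
  have h2 : 0 ≤ D + K * t := nonneg_of_mul_nonneg_right h1 ht0
  nlinarith [le_abs_self K]

theorem stmt4 (n m : ℕ)
    (U : Set (EuclideanSpace ℝ (Fin n)))
    (hUne : U.Nonempty) (hUcl : IsClosed U) (hUcx : Convex ℝ U)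
    (C : Set (EuclideanSpace ℝ (Fin m)))
    (hCne : C.Nonempty) (hCcl : IsClosed C) (hCcx : Convex ℝ C)
    (hCcone : ∀ c ∈ C, ∀ t : ℝ, 0 < t → t • c ∈ C)
    (Cstar : Set (EuclideanSpace ℝ (Fin m)))
    (hCstar : Cstar = {p | ∀ c ∈ C, 0 ≤ ⟪p, c⟫})
    (G : EuclideanSpace ℝ (Fin n) → EuclideanSpace ℝ (Fin n)) (hG : Continuous G)
    (J : EuclideanSpace ℝ (Fin n) → ℝ) (hJ : ConvexOn ℝ Set.univ J)
    (Θ : EuclideanSpace ℝ (Fin n) → EuclideanSpace ℝ (Fin m)) (hΘc : Continuous Θ)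
    (hΘcx : ∀ u v : EuclideanSpace ℝ (Fin n), ∀ a : ℝ, a ∈ Set.Icc (0 : ℝ) 1 →
      Θ (a • u + (1 - a) • v) - a • Θ u - (1 - a) • Θ v ∈ -C)
    (τ : ℝ) (hτ : 0 < τ)
    (hΘLip : ∀ u v : EuclideanSpace ℝ (Fin n), ‖Θ u - Θ v‖ ≤ τ * ‖u - v‖)
    (γ : ℝ) (hγ : 0 < γ)
    (φ : EuclideanSpace ℝ (Fin m) → EuclideanSpace ℝ (Fin m) → ℝ)
    (hφ : ∀ θ p, φ θ p =
      sSup ((fun q => ⟪q, θ⟫ - ‖q - p‖ ^ 2 / (2 * γ)) '' Cstar))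
    (ustar : EuclideanSpace ℝ (Fin n)) (hustar : ustar ∈ U)
    (pstar : EuclideanSpace ℝ (Fin m)) (hpstar : pstar ∈ Cstar) :
    ((∀ p ∈ Cstar, ⟪G ustar, ustar⟫ + J ustar + ⟪p, Θ ustar⟫ ≤
        ⟪G ustar, ustar⟫ + J ustar + ⟪pstar, Θ ustar⟫) ∧
     (∀ x ∈ U, ⟪G ustar, ustar⟫ + J ustar + ⟪pstar, Θ ustar⟫ ≤
        ⟪G ustar, x⟫ + J x + ⟪pstar, Θ x⟫))
    ↔
    ((∀ p ∈ Cstar, ⟪G ustar, ustar⟫ + J ustar + φ (Θ ustar) p ≤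
        ⟪G ustar, ustar⟫ + J ustar + φ (Θ ustar) pstar) ∧
     (∀ x ∈ U, ⟪G ustar, ustar⟫ + J ustar + φ (Θ ustar) pstar ≤
        ⟪G ustar, x⟫ + J x + φ (Θ x) pstar)) := by
  have hzero : (0 : EuclideanSpace ℝ (Fin m)) ∈ Cstar := by simp [hCstar]
  have hcone : ∀ p ∈ Cstar, ∀ t : ℝ, 0 ≤ t → t • p ∈ Cstar := by
    subst hCstar
    intro p hp t ht c hc
    rw [real_inner_smul_left]
    exact mul_nonneg ht (hp c hc)
  have hlow : ∀ θ, ∀ p ∈ Cstar, ⟪p, θ⟫ ≤ φ θ p := fun θ p hp => by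
    rw [hφ]
    exact inner_le_sSup_inner_sub_sq_norm_sub_div hγ θ hp
  have hup : ∀ θ p M, (∀ q ∈ Cstar, ⟪q, θ⟫ - ‖q - p‖ ^ 2 / (2 * γ) ≤ M) → φ θ p ≤ M := by
    intro θ p M hM
    rw [hφ]
    refine csSup_le ⟨_, 0, hzero, rfl⟩ ?_
    rintro _ ⟨q, hq, rfl⟩
    exact hM q hq
  constructor
  · rintro ⟨h1, h2⟩
    have hle : ∀ p, φ (Θ ustar) p ≤ ⟪pstar, Θ ustar⟫ := fun p => hup _ _ _ fun q hq => by
      have : 0 ≤ ‖q - p‖ ^ 2 / (2 * γ) := by positivity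
      linarith [h1 q hq]
    refine ⟨fun p _ => ?_, fun x hx => ?_⟩
    · linarith [hle p, hlow (Θ ustar) pstar hpstar]
    · linarith [hle pstar, hlow (Θ x) pstar hpstar, h2 x hx]
  · rintro ⟨h1, h2⟩
    have hM : ∀ p ∈ Cstar, ⟪p, Θ ustar⟫ ≤ φ (Θ ustar) pstar := fun p hp => by
      linarith [h1 p hp, hlow (Θ ustar) p hp]
    have hnp : ∀ p ∈ Cstar, ⟪p, Θ ustar⟫ ≤ 0 := fun p hp =>
      inner_nonpos_of_forall_inner_le hcone hM hp
    have hS : 0 ≤ φ (Θ ustar) pstar := by simpa using hM 0 hzero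
    have heq : ⟪pstar, Θ ustar⟫ = 0 :=
      inner_eq_zero_of_sSup_nonneg hγ hnp hpstar (by rwa [← hφ])
    refine ⟨fun p hp => by linarith [hnp p hp], fun x hx => ?_⟩
    suffices h : 0 ≤ ⟪G ustar, x⟫ - ⟪G ustar, ustar⟫ + (J x - J ustar) + ⟪pstar, Θ x⟫ by
      linarith
    refine nonneg_of_forall_mul_add_mul_sq_nonneg
      (K := γ / 2 * (τ * ‖x - ustar‖) ^ 2) fun t ht0 ht1 => ?_
    obtain ⟨y, hy⟩ : ∃ y, y = t • x + (1 - t) • ustar := ⟨_, rfl⟩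
    have hyU : y ∈ U := hy ▸ hUcx hx hustar ht0.le (by linarith) (by ring)
    have hJy : J y ≤ t * J x + (1 - t) * J ustar := by
      rw [hy]
      exact hJ.2 (Set.mem_univ x) (Set.mem_univ ustar) ht0.le (by linarith) (by ring)
    have hGy : ⟪G ustar, y⟫ = t * ⟪G ustar, x⟫ + (1 - t) * ⟪G ustar, ustar⟫ := by
      rw [hy, inner_add_right, inner_smul_right, inner_smul_right]
    have hΘy : ⟪pstar, Θ y⟫ ≤ t * ⟪pstar, Θ x⟫ := by
      have hc := hΘcx x ustar t ⟨ht0.le, ht1⟩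
      rw [← hy, Set.mem_neg] at hc
      have hp := hpstar
      rw [hCstar] at hp
      have h := hp _ hc
      rw [inner_neg_right, inner_sub_right, inner_sub_right, inner_smul_right,
        inner_smul_right, heq] at h
      linarith
    have hdist : ‖Θ y - Θ ustar‖ ≤ t * (τ * ‖x - ustar‖) := by
      have h := hΘLip y ustar
      have hyx : y - ustar = t • (x - ustar) := by rw [hy]; module
      rw [hyx, norm_smul, Real.norm_of_nonneg ht0.le] at h
      linarith
    have hφy : φ (Θ y) pstar ≤ ⟪pstar, Θ y⟫ + γ / 2 * ‖Θ y - Θ ustar‖ ^ 2 :=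
      hup _ _ _ fun q hq => by
        have h := inner_sub_sq_norm_sub_div_le hγ q pstar (Θ y - Θ ustar)
        rw [inner_sub_right, inner_sub_right, heq] at h
        linarith [hnp q hq]
    have hsq : γ / 2 * ‖Θ y - Θ ustar‖ ^ 2 ≤ γ / 2 * (t * (τ * ‖x - ustar‖)) ^ 2 := by
      gcongr
    linarith [h2 y hyU]
end

section
/- If (u♮, p♮) ∈ U × C* solves (MVIS), then u♮ solves (VIP); that is, u♮ ∈ Γ and ⟨G(u♮), v − u♮⟩ + J(v) − J(u♮) ≥ 0 for all v ∈ Γ. -/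
open RealInnerProductSpace

/-- The bipolar theorem for a nonempty closed convex cone. -/
theorem mem_of_forall_dual_inner_nonneg {E : Type*} [NormedAddCommGroup E]
    [InnerProductSpace ℝ E] [CompleteSpace E] {C : Set E} (hne : C.Nonempty) (hcl : IsClosed C)
    (hcx : Convex ℝ C) (hcone : ∀ c ∈ C, ∀ t : ℝ, 0 < t → t • c ∈ C) {b : E}
    (hb : ∀ p : E, (∀ c ∈ C, 0 ≤ ⟪p, c⟫) → 0 ≤ ⟪p, b⟫) : b ∈ C := by
  by_contra hbC
  obtain ⟨f, s, hfb, hfC⟩ := geometric_hahn_banach_point_closed hcx hcl hbC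
  have hscale : ∀ c ∈ C, ∀ t : ℝ, 0 < t → s < t * f c := fun c hc t ht => by
    simpa using hfC _ (hcone c hc t ht)
  have hnonneg : ∀ c ∈ C, 0 ≤ f c := by
    intro c hc
    by_contra! hneg
    have hs : s < 0 := (hfC c hc).trans hneg
    have h := hscale c hc (s / f c) (div_pos_of_neg_of_neg hs hneg)
    rw [div_mul_cancel₀ _ hneg.ne] at h
    exact lt_irrefl _ h
  have hfb0 : 0 ≤ f b := by
    simpa using hb ((InnerProductSpace.toDual ℝ E).symm f) (by simpa using hnonneg)
  obtain ⟨c, hc⟩ := hne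
  have hs : 0 < s := hfb0.trans_lt hfb
  have hfc : 0 < f c := hs.trans (hfC c hc)
  have h := hscale c hc (s / f c) (div_pos hs hfc)
  rw [div_mul_cancel₀ _ hfc.ne'] at h
  exact lt_irrefl _ h

theorem stmt7 (n m : ℕ)
    (U : Set (EuclideanSpace ℝ (Fin n)))
    (hUne : U.Nonempty) (hUcl : IsClosed U) (hUcx : Convex ℝ U)
    (C : Set (EuclideanSpace ℝ (Fin m)))
    (hCne : C.Nonempty) (hCcl : IsClosed C) (hCcx : Convex ℝ C)
    (hCcone : ∀ c ∈ C, ∀ t : ℝ, 0 < t → t • c ∈ C)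
    (Cstar : Set (EuclideanSpace ℝ (Fin m)))
    (hCstar : Cstar = {p | ∀ c ∈ C, 0 ≤ ⟪p, c⟫})
    (G : EuclideanSpace ℝ (Fin n) → EuclideanSpace ℝ (Fin n)) (hG : Continuous G)
    (J : EuclideanSpace ℝ (Fin n) → ℝ) (hJ : ConvexOn ℝ Set.univ J)
    (Θ : EuclideanSpace ℝ (Fin n) → EuclideanSpace ℝ (Fin m)) (hΘc : Continuous Θ)
    (hΘcx : ∀ u v : EuclideanSpace ℝ (Fin n), ∀ a : ℝ, a ∈ Set.Icc (0 : ℝ) 1 →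
      Θ (a • u + (1 - a) • v) - a • Θ u - (1 - a) • Θ v ∈ -C)
    (Γ : Set (EuclideanSpace ℝ (Fin n)))
    (hΓ : Γ = {x ∈ U | Θ x ∈ -C})
    (ustar : EuclideanSpace ℝ (Fin n)) (hustar : ustar ∈ U)
    (pstar : EuclideanSpace ℝ (Fin m)) (hpstar : pstar ∈ Cstar)
    (hMVIS1 : ∀ x ∈ U, 0 ≤ ⟪G x, x - ustar⟫ + J x - J ustar + ⟪pstar, Θ x - Θ ustar⟫)
    (hMVIS2 : ∀ p ∈ Cstar, ⟪Θ ustar, p - pstar⟫ ≤ 0) :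
    ustar ∈ Γ ∧ ∀ x ∈ Γ, 0 ≤ ⟪G ustar, x - ustar⟫ + J x - J ustar := by
  subst hCstar hΓ
  have hzero := hMVIS2 0 (fun c _ => by simp)
  have hdouble := hMVIS2 ((2 : ℝ) • pstar) (fun c hc => by
    rw [real_inner_smul_left]
    exact mul_nonneg zero_le_two (hpstar c hc))
  rw [inner_sub_right, inner_zero_right] at hzero
  rw [inner_sub_right, real_inner_smul_right] at hdouble
  have hcomp : ⟪Θ ustar, pstar⟫ = 0 := by linarith
  have hfeas : Θ ustar ∈ -C := by
    refine mem_of_forall_dual_inner_nonneg hCne hCcl hCcx hCcone fun p hp => ?_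
    have h := hMVIS2 p hp
    rw [inner_sub_right, hcomp, real_inner_comm] at h
    rw [inner_neg_right]
    linarith
  refine ⟨⟨hustar, hfeas⟩, ?_⟩
  rintro x ⟨hxU, hxC⟩
  have hpx : ⟪pstar, Θ x⟫ ≤ 0 := by
    have h := hpstar _ hxC
    rw [inner_neg_right] at h
    linarith
  have hsegment : ∀ t ∈ Set.Ioc (0 : ℝ) 1,
      0 ≤ ⟪G (t • x + (1 - t) • ustar), x - ustar⟫ + J x - J ustar := by
    rintro t ⟨ht0, ht1⟩
    have ht1' : 0 ≤ 1 - t := sub_nonneg.2 ht1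
    have hM := hMVIS1 _ (hUcx hxU hustar ht0.le ht1' (by ring))
    have hJt := hJ.2 (Set.mem_univ x) (Set.mem_univ ustar) ht0.le ht1' (by ring)
    have hΘt := hpstar _ (hΘcx x ustar t ⟨ht0.le, ht1⟩)
    have hdir : t • x + (1 - t) • ustar - ustar = t • (x - ustar) := by module
    rw [hdir, real_inner_smul_right, inner_sub_right] at hM
    rw [real_inner_comm] at hcomp
    simp only [inner_neg_right, inner_sub_right, real_inner_smul_right, hcomp] at hM hΘt
    simp only [smul_eq_mul] at hJt
    have hneg := mul_nonpos_of_nonneg_of_nonpos ht0.le hpx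
    rw [inner_sub_right]
    refine nonneg_of_mul_nonneg_right (a := t) ?_ ht0
    nlinarith
  have hcont : Continuous fun t : ℝ =>
      ⟪G (t • x + (1 - t) • ustar), x - ustar⟫ + J x - J ustar := by
    fun_prop
  have hlim := (hcont.tendsto 0).mono_left (nhdsWithin_le_nhds (s := Set.Ioi 0))
  simp only [zero_smul, sub_zero, one_smul, zero_add] at hlim
  refine ge_of_tendsto hlim ?_
  filter_upwards [Ioc_mem_nhdsGT (zero_lt_one' ℝ)] with t ht using hsegment t ht
end

section
/- If (u♮, p♮) ∈ U × C* solves (MVIS), then (u♮, p♮) solves (VIS); that is, ⟨G(u♮), v − u♮⟩ + J(v) − J(u♮) + ⟨p♮, Θ(v) − Θ(u♮)⟩ ≥ 0 for all v ∈ U and ⟨Θ(u♮), p − p♮⟩ ≤ 0 for all p ∈ C*. -/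
open RealInnerProductSpace

theorem stmt8 (n m : ℕ)
    (U : Set (EuclideanSpace ℝ (Fin n)))
    (hUne : U.Nonempty) (hUcl : IsClosed U) (hUcx : Convex ℝ U)
    (C : Set (EuclideanSpace ℝ (Fin m)))
    (hCne : C.Nonempty) (hCcl : IsClosed C) (hCcx : Convex ℝ C)
    (hCcone : ∀ c ∈ C, ∀ t : ℝ, 0 < t → t • c ∈ C)
    (Cstar : Set (EuclideanSpace ℝ (Fin m)))
    (hCstar : Cstar = {p | ∀ c ∈ C, 0 ≤ ⟪p, c⟫})
    (G : EuclideanSpace ℝ (Fin n) → EuclideanSpace ℝ (Fin n)) (hG : Continuous G)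
    (J : EuclideanSpace ℝ (Fin n) → ℝ) (hJ : ConvexOn ℝ Set.univ J)
    (Θ : EuclideanSpace ℝ (Fin n) → EuclideanSpace ℝ (Fin m)) (hΘc : Continuous Θ)
    (hΘcx : ∀ u v : EuclideanSpace ℝ (Fin n), ∀ a : ℝ, a ∈ Set.Icc (0 : ℝ) 1 →
      Θ (a • u + (1 - a) • v) - a • Θ u - (1 - a) • Θ v ∈ -C)
    (unat : EuclideanSpace ℝ (Fin n)) (hunat : unat ∈ U)
    (pnat : EuclideanSpace ℝ (Fin m)) (hpnat : pnat ∈ Cstar)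
    (hMVIS1 : ∀ x ∈ U, 0 ≤ ⟪G x, x - unat⟫ + J x - J unat + ⟪pnat, Θ x - Θ unat⟫)
    (hMVIS2 : ∀ p ∈ Cstar, ⟪Θ unat, p - pnat⟫ ≤ 0) :
    (∀ x ∈ U, 0 ≤ ⟪G unat, x - unat⟫ + J x - J unat + ⟪pnat, Θ x - Θ unat⟫) ∧
    (∀ p ∈ Cstar, ⟪Θ unat, p - pnat⟫ ≤ 0) := by
  refine ⟨fun x hx => ?_, hMVIS2⟩
  have key : ∀ a ∈ Set.Ioo (0 : ℝ) 1,
      0 ≤ ⟪G (a • x + (1 - a) • unat), x - unat⟫ + J x - J unat + ⟪pnat, Θ x - Θ unat⟫ := by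
    rintro a ⟨ha0, ha1⟩
    have hmvis := hMVIS1 _ (hUcx hx hunat ha0.le (sub_nonneg.2 ha1.le) (by ring))
    have hJa := hJ.2 (Set.mem_univ x) (Set.mem_univ unat) ha0.le (sub_nonneg.2 ha1.le) (by ring)
    have hΘa := hΘcx x unat a ⟨ha0.le, ha1.le⟩
    rw [hCstar] at hpnat
    have hp := hpnat _ (Set.mem_neg.1 hΘa)
    have hdir : a • x + (1 - a) • unat - unat = a • (x - unat) := by module
    rw [hdir, real_inner_smul_right] at hmvis
    simp only [inner_neg_right, inner_sub_right, real_inner_smul_right, smul_eq_mul]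
      at hmvis hJa hp ⊢
    refine nonneg_of_mul_nonneg_right ?_ ha0
    linarith
  have hlim : Filter.Tendsto
      (fun a : ℝ => ⟪G (a • x + (1 - a) • unat), x - unat⟫ + J x - J unat + ⟪pnat, Θ x - Θ unat⟫)
      (nhdsWithin 0 (Set.Ioi 0))
      (nhds (⟪G unat, x - unat⟫ + J x - J unat + ⟪pnat, Θ x - Θ unat⟫)) := by
    refine Filter.Tendsto.mono_left ?_ nhdsWithin_le_nhds
    refine Continuous.tendsto' (by fun_prop) _ _ (by simp)
  exact ge_of_tendsto hlim (Filter.eventually_of_mem (Ioo_mem_nhdsGT one_pos) key)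
end

section
/- Assume the ALAVI setting, and let u⋆ ∈ Γ be a solution of (VIP), i.e. ⟨G(u⋆), u − u⋆⟩ + J(u) − J(u⋆) ≥ 0 for all u ∈ Γ. Define L_{u⋆}(u, p) = ⟨G(u⋆), u⟩ + J(u) + ⟨p, Θ(u)⟩. Then for every k ≥ 1 and every (u, p) ∈ U × C*: Λᵏ(u, p) − Λᵏ⁺¹(u, p) ≥ (L_{u⋆}(uᵏ, p) − L_{u⋆}(u, qᵏ)) + ⟨G(uᵏ) − G(u⋆), uᵏ − u⟩ + ρ(‖wᵏ⁻¹ − wᵏ‖² + ‖pᵏ − qᵏ‖²). -/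
open RealInnerProductSpace

/-- The Stewart-type identity for the squared norm of an affine combination. -/
theorem norm_sq_affine_combination {E : Type*} [NormedAddCommGroup E] [InnerProductSpace ℝ E]
    (x y : E) (a : ℝ) :
    ‖a • x + (1 - a) • y‖ ^ 2 = a * ‖x‖ ^ 2 + (1 - a) * ‖y‖ ^ 2 - a * (1 - a) * ‖x - y‖ ^ 2 := by
  rw [norm_add_sq_real, norm_sub_sq_real, norm_smul, norm_smul, real_inner_smul_left,
    real_inner_smul_right, mul_pow, mul_pow, Real.norm_eq_abs, Real.norm_eq_abs, sq_abs, sq_abs]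
  ring

/-- The three-point inequality for a minimizer of a convex function plus a squared distance. -/
theorem ConvexOn.prox_three_point {E : Type*} [NormedAddCommGroup E] [InnerProductSpace ℝ E]
    {s : Set E} {f : E → ℝ} {c : ℝ} (hc : 0 < c) (hf : ConvexOn ℝ s f) {u v : E} (hu : u ∈ s)
    (hmin : ∀ x ∈ s, f u + c * ‖u - v‖ ^ 2 ≤ f x + c * ‖x - v‖ ^ 2) {x : E} (hx : x ∈ s) :
    f u - f x ≤ c * (‖x - v‖ ^ 2 - ‖u - v‖ ^ 2 - ‖x - u‖ ^ 2) := by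
  set B := c * ‖x - u‖ ^ 2 with hB
  set A := f u + c * ‖u - v‖ ^ 2 - f x - c * ‖x - v‖ ^ 2 with hA
  have hB0 : 0 ≤ B := by positivity
  have key : ∀ t : ℝ, 0 < t → t ≤ 1 → A + B ≤ t * B := by
    intro t ht ht1
    have hmem := hf.1 hx hu ht.le (sub_nonneg.2 ht1) (by ring)
    have hconv := hf.2 hx hu ht.le (sub_nonneg.2 ht1) (by ring)
    have hm := hmin _ hmem
    have hsplit : t • x + (1 - t) • u - v = t • (x - v) + (1 - t) • (u - v) := by module
    rw [hsplit, norm_sq_affine_combination, sub_sub_sub_cancel_right] at hm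
    simp only [smul_eq_mul] at hconv
    refine le_of_mul_le_mul_left ?_ ht
    rw [hA, hB]
    linarith
  have hAB : A + B ≤ 0 := by
    by_contra! h
    have h1 := key 1 one_pos le_rfl
    have h2 := key ((A + B) / (2 * B + 1)) (by positivity)
      ((div_le_one (by positivity)).2 (by linarith))
    rw [div_mul_eq_mul_div, le_div_iff₀ (by positivity)] at h2
    nlinarith
  rw [hA, hB] at hAB
  linarith

/-- A projection onto a convex set in variational form is nonexpansive. -/
theorem norm_sub_le_of_variational_projection {E : Type*} [NormedAddCommGroup E]
    [InnerProductSpace ℝ E] {s : Set E} {P : E → E}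
    (hP : ∀ x, P x ∈ s ∧ ∀ y ∈ s, ⟪x - P x, y - P x⟫ ≤ 0) (x y : E) :
    ‖P x - P y‖ ≤ ‖x - y‖ := by
  have h1 := (hP x).2 _ (hP y).1
  have h2 := (hP y).2 _ (hP x).1
  have h3 : ‖P x - P y‖ ^ 2 =
      ⟪x - y, P x - P y⟫ + ⟪x - P x, P y - P x⟫ + ⟪y - P y, P x - P y⟫ := by
    rw [← real_inner_self_eq_norm_sq]
    simp only [inner_sub_left, inner_sub_right]
    ring
  have h4 := real_inner_le_norm (x - y) (P x - P y)
  have h5 := norm_nonneg (P x - P y)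
  by_contra! h
  nlinarith [norm_nonneg (x - y)]

theorem stmt12 (n m : ℕ)
    (U : Set (EuclideanSpace ℝ (Fin n)))
    (hUne : U.Nonempty) (hUcl : IsClosed U) (hUcx : Convex ℝ U)
    (C : Set (EuclideanSpace ℝ (Fin m)))
    (hCne : C.Nonempty) (hCcl : IsClosed C) (hCcx : Convex ℝ C)
    (hCcone : ∀ c ∈ C, ∀ t : ℝ, 0 < t → t • c ∈ C)
    (Cstar : Set (EuclideanSpace ℝ (Fin m)))
    (hCstar : Cstar = {p | ∀ c ∈ C, 0 ≤ ⟪p, c⟫})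
    (G : EuclideanSpace ℝ (Fin n) → EuclideanSpace ℝ (Fin n)) (hG : Continuous G)
    (J : EuclideanSpace ℝ (Fin n) → ℝ) (hJ : ConvexOn ℝ Set.univ J)
    (Θ : EuclideanSpace ℝ (Fin n) → EuclideanSpace ℝ (Fin m)) (hΘc : Continuous Θ)
    (hΘcx : ∀ x y : EuclideanSpace ℝ (Fin n), ∀ a : ℝ, a ∈ Set.Icc (0 : ℝ) 1 →
      Θ (a • x + (1 - a) • y) - a • Θ x - (1 - a) • Θ y ∈ -C)
    (Γ : Set (EuclideanSpace ℝ (Fin n)))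
    (hΓ : Γ = {x ∈ U | Θ x ∈ -C})
    (Pi : EuclideanSpace ℝ (Fin m) → EuclideanSpace ℝ (Fin m))
    (hPi : ∀ x, Pi x ∈ Cstar ∧ ∀ y ∈ Cstar, ⟪x - Pi x, y - Pi x⟫ ≤ 0)
    (L τ η γ α : ℝ) (hL : 0 ≤ L) (hτ : 0 < τ)
    (hGLip : ∀ x ∈ U, ∀ y ∈ U, ‖G x - G y‖ ≤ L * ‖x - y‖)
    (hΘLip : ∀ x y : EuclideanSpace ℝ (Fin n), ‖Θ x - Θ y‖ ≤ τ * ‖x - y‖)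
    (hη₁ : (Real.sqrt 5 - 1) / 2 ≤ η) (hη₂ : η < 1)
    (hγ₁ : 0 < γ) (hγ₂ : γ < 1 / τ)
    (hα₁ : 0 < α) (hα₂ : α ≤ 1 / (2 * (γ * τ ^ 2 + L + τ) * η))
    (u v : ℕ → EuclideanSpace ℝ (Fin n)) (p q : ℕ → EuclideanSpace ℝ (Fin m))
    (hu0 : u 0 ∈ U)
    (hq : ∀ k, q k = Pi (p k + γ • Θ (u k)))
    (huU : ∀ k, u (k + 1) ∈ U)
    (humin : ∀ k, ∀ x ∈ U,
      ⟪G (u k), u (k + 1)⟫ + J (u (k + 1)) + ⟪q k, Θ (u (k + 1))⟫ +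
          ‖u (k + 1) - v k‖ ^ 2 / (2 * α) ≤
        ⟪G (u k), x⟫ + J x + ⟪q k, Θ x⟫ + ‖x - v k‖ ^ 2 / (2 * α))
    (hp : ∀ k, p (k + 1) = Pi (p k + γ • Θ (u (k + 1))))
    (hv : ∀ k, v (k + 1) = (1 - η) • u (k + 1) + η • v k)
    (ρ : ℝ)
    (hρ : ρ = min (η / (2 * α * (1 - η) ^ 2))
      (min (τ / 2) (min ((1 - τ * γ) / (2 * γ)) (1 / γ))))
    (Λ : ℕ → EuclideanSpace ℝ (Fin n) → EuclideanSpace ℝ (Fin m) → ℝ)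
    (hΛ : ∀ k x y, Λ (k + 1) x y =
      (1 / (2 * α * (1 - η))) * ‖v (k + 1) - x‖ ^ 2 +
      ((γ * τ ^ 2 + L + τ) / 2) * ‖u k - u (k + 1)‖ ^ 2 +
      (1 / (2 * γ)) * ‖p k - y‖ ^ 2)
    (ustar : EuclideanSpace ℝ (Fin n)) (hustar : ustar ∈ Γ)
    (hVIP : ∀ x ∈ Γ, 0 ≤ ⟪G ustar, x - ustar⟫ + J x - J ustar) :
    ∀ k : ℕ, ∀ x ∈ U, ∀ y ∈ Cstar,
      ((⟪G ustar, u (k + 1)⟫ + J (u (k + 1)) + ⟪y, Θ (u (k + 1))⟫) -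
        (⟪G ustar, x⟫ + J x + ⟪q (k + 1), Θ x⟫)) +
      ⟪G (u (k + 1)) - G ustar, u (k + 1) - x⟫ +
      ρ * ((‖v k - v (k + 1)‖ ^ 2 + ‖u k - u (k + 1)‖ ^ 2 + ‖p k - p (k + 1)‖ ^ 2) +
        ‖p (k + 1) - q (k + 1)‖ ^ 2) ≤
      Λ (k + 1) x y - Λ (k + 2) x y := by
  intro k x hx y hy
  have hη0 : 0 < η := by
    have : (1 : ℝ) < Real.sqrt 5 := by
      rw [Real.lt_sqrt] <;> norm_num
    linarith
  have hηsq : 1 ≤ η ^ 2 + η := by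
    have h5 := Real.sq_sqrt (show (0 : ℝ) ≤ 5 by norm_num)
    nlinarith [Real.sqrt_nonneg 5]
  have hη1 : 0 < 1 - η := by linarith
  have huU' : ∀ j, u j ∈ U := fun j => by
    cases j with
    | zero => exact hu0
    | succ j => exact huU j
  have hqC : ∀ j, q j ∈ Cstar := fun j => hq j ▸ (hPi _).1
  have hpC : p (k + 1) ∈ Cstar := hp k ▸ (hPi _).1
  have hconv : ∀ j, ConvexOn ℝ U fun z => ⟪G (u j), z⟫ + J z + ⟪q j, Θ z⟫ := by
    intro j
    refine ⟨hUcx, fun z _ w _ a b ha hb hab => ?_⟩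
    obtain rfl : b = 1 - a := by linarith
    have h1 := hJ.2 (Set.mem_univ z) (Set.mem_univ w) ha hb hab
    have h2 := hΘcx z w a ⟨ha, by linarith⟩
    have h3 := hqC j
    rw [hCstar] at h3
    have h4 := h3 _ h2
    simp only [inner_neg_right, inner_sub_right, inner_add_right, real_inner_smul_right,
      smul_eq_mul] at h1 h4 ⊢
    linarith
  set c := 1 / (2 * α) with hc
  have hc0 : 0 < c := by positivity
  have hprox : ∀ j, ∀ z ∈ U,
      (⟪G (u j), u (j + 1)⟫ + J (u (j + 1)) + ⟪q j, Θ (u (j + 1))⟫) -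
        (⟪G (u j), z⟫ + J z + ⟪q j, Θ z⟫) ≤
      c * (‖z - v j‖ ^ 2 - ‖u (j + 1) - v j‖ ^ 2 - ‖z - u (j + 1)‖ ^ 2) := fun j z hz => by
    refine (hconv j).prox_three_point hc0 (huU j) (fun w hw => ?_) hz
    have := humin j w hw
    rw [div_eq_mul_one_div, div_eq_mul_one_div (‖w - v j‖ ^ 2), ← hc] at this
    linarith
  have hnew := hprox (k + 1) x hx
  have hold := hprox k (u (k + 1 + 1)) (huU _)
  have hv₁ : ‖v (k + 1 + 1) - x‖ ^ 2 = (1 - η) * ‖u (k + 1 + 1) - x‖ ^ 2 +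
      η * ‖v (k + 1) - x‖ ^ 2 - η * (1 - η) * ‖u (k + 1 + 1) - v (k + 1)‖ ^ 2 := by
    have h := norm_sq_affine_combination (u (k + 1 + 1) - x) (v (k + 1) - x) (1 - η)
    rw [sub_sub_sub_cancel_right] at h
    rw [hv (k + 1), show (1 - η) • u (k + 1 + 1) + η • v (k + 1) - x =
      (1 - η) • (u (k + 1 + 1) - x) + (1 - (1 - η)) • (v (k + 1) - x) by module, h]
    ring
  have hv₂ : ‖u (k + 1 + 1) - v (k + 1)‖ ^ 2 = (1 - η) * ‖u (k + 1 + 1) - u (k + 1)‖ ^ 2 +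
      η * ‖u (k + 1 + 1) - v k‖ ^ 2 - η * (1 - η) * ‖u (k + 1) - v k‖ ^ 2 := by
    have h := norm_sq_affine_combination (u (k + 1 + 1) - u (k + 1)) (u (k + 1 + 1) - v k) (1 - η)
    rw [sub_sub_sub_cancel_left, norm_sub_rev (v k)] at h
    rw [hv k, show u (k + 1 + 1) - ((1 - η) • u (k + 1) + η • v k) =
      (1 - η) • (u (k + 1 + 1) - u (k + 1)) + (1 - (1 - η)) • (u (k + 1 + 1) - v k) by module, h]
    ring
  have hv₃ : ‖v k - v (k + 1)‖ ^ 2 = (1 - η) ^ 2 * ‖u (k + 1) - v k‖ ^ 2 := by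
    rw [hv k, show v k - ((1 - η) • u (k + 1) + η • v k) =
      (-(1 - η)) • (u (k + 1) - v k) by module, norm_smul, mul_pow, Real.norm_eq_abs, sq_abs]
    ring
  have hGterm : -(L / 2 * (‖u k - u (k + 1)‖ ^ 2 + ‖u (k + 1 + 1) - u (k + 1)‖ ^ 2)) ≤
      ⟪G (u (k + 1)) - G (u k), u (k + 1 + 1) - u (k + 1)⟫ := by
    have h1 := hGLip _ (huU' k) _ (huU' (k + 1))
    have h2 := neg_le_of_abs_le
      (abs_real_inner_le_norm (G (u (k + 1)) - G (u k)) (u (k + 1 + 1) - u (k + 1)))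
    rw [norm_sub_rev (G (u (k + 1)))] at h2
    have h3 := mul_le_mul_of_nonneg_right h1 (norm_nonneg (u (k + 1 + 1) - u (k + 1)))
    have h4 := mul_nonneg hL (sq_nonneg (‖u k - u (k + 1)‖ - ‖u (k + 1 + 1) - u (k + 1)‖))
    linarith
  have hdual₁ : ⟪y - p (k + 1), Θ (u (k + 1))⟫ ≤
      1 / (2 * γ) * (‖p k - y‖ ^ 2 - ‖p (k + 1) - y‖ ^ 2 - ‖p k - p (k + 1)‖ ^ 2) := by
    have h := (hPi (p k + γ • Θ (u (k + 1)))).2 y hy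
    rw [← hp k] at h
    have h' : γ * ⟪y - p (k + 1), Θ (u (k + 1))⟫ ≤
        (‖p k - y‖ ^ 2 - ‖p (k + 1) - y‖ ^ 2 - ‖p k - p (k + 1)‖ ^ 2) / 2 := by
      simp only [← real_inner_self_eq_norm_sq]
      simp only [inner_sub_left, inner_sub_right, inner_add_left, real_inner_smul_left] at h ⊢
      rw [real_inner_comm (Θ (u (k + 1))) y, real_inner_comm (Θ (u (k + 1))) (p (k + 1))]
      linarith [real_inner_comm y (p k), real_inner_comm y (p (k + 1)),
        real_inner_comm (p k) (p (k + 1))]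
    rw [one_div, inv_mul_eq_div, le_div_iff₀ (by positivity)]
    linarith
  have hdual₂ : ⟪p (k + 1) - q (k + 1), Θ (u (k + 1))⟫ ≤
      -(1 / γ * ‖p (k + 1) - q (k + 1)‖ ^ 2) := by
    have h := (hPi (p (k + 1) + γ • Θ (u (k + 1)))).2 _ hpC
    rw [← hq (k + 1), add_sub_right_comm, inner_add_left, real_inner_smul_left,
      real_inner_self_eq_norm_sq, real_inner_comm] at h
    rw [one_div, inv_mul_eq_div, ← neg_div, le_div_iff₀ hγ₁]
    linarith
  have hqLip : ‖q (k + 1) - q k‖ ≤ ‖p k - p (k + 1)‖ + γ * (τ * ‖u k - u (k + 1)‖) := by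
    have h := norm_sub_le_of_variational_projection hPi
      (p k + γ • Θ (u k)) (p (k + 1) + γ • Θ (u (k + 1)))
    rw [← hq k, ← hq (k + 1), add_sub_add_comm, ← smul_sub, norm_sub_rev] at h
    refine h.trans ((norm_add_le _ _).trans ?_)
    rw [norm_smul, Real.norm_of_nonneg hγ₁.le]
    gcongr
    exact hΘLip _ _
  have hdual₃ : ⟪q (k + 1) - q k, Θ (u (k + 1)) - Θ (u (k + 1 + 1))⟫ ≤
      τ / 2 * (‖p k - p (k + 1)‖ ^ 2 + ‖u (k + 1 + 1) - u (k + 1)‖ ^ 2) +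
      γ * τ ^ 2 / 2 * (‖u k - u (k + 1)‖ ^ 2 + ‖u (k + 1 + 1) - u (k + 1)‖ ^ 2) := by
    have h1 := real_inner_le_norm (q (k + 1) - q k) (Θ (u (k + 1)) - Θ (u (k + 1 + 1)))
    have h2 := hΘLip (u (k + 1)) (u (k + 1 + 1))
    rw [norm_sub_rev (u (k + 1))] at h2
    have h3 := mul_le_mul hqLip h2 (norm_nonneg _) (by positivity)
    have h4 := mul_nonneg hτ.le (sq_nonneg (‖p k - p (k + 1)‖ - ‖u (k + 1 + 1) - u (k + 1)‖))
    have h5 := mul_nonneg (by positivity : 0 ≤ γ * τ ^ 2)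
      (sq_nonneg (‖u k - u (k + 1)‖ - ‖u (k + 1 + 1) - u (k + 1)‖))
    linarith
  have hα : γ * τ ^ 2 + L + τ ≤ c / η := by
    rw [hc, div_div, le_div_iff₀ (by positivity)]
    rw [le_div_iff₀ (by positivity)] at hα₂
    linarith
  have hprimal : c * (‖x - v (k + 1)‖ ^ 2 - ‖u (k + 1 + 1) - v (k + 1)‖ ^ 2 -
        ‖x - u (k + 1 + 1)‖ ^ 2) +
      c * (‖u (k + 1 + 1) - v k‖ ^ 2 - ‖u (k + 1) - v k‖ ^ 2 -
        ‖u (k + 1 + 1) - u (k + 1)‖ ^ 2) ≤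
      1 / (2 * α * (1 - η)) * (‖v (k + 1) - x‖ ^ 2 - ‖v (k + 1 + 1) - x‖ ^ 2) -
      (γ * τ ^ 2 + L + τ) * ‖u (k + 1 + 1) - u (k + 1)‖ ^ 2 -
      η / (2 * α * (1 - η) ^ 2) * ‖v k - v (k + 1)‖ ^ 2 := by
    rw [norm_sub_rev x, norm_sub_rev x]
    have h1 := mul_le_mul_of_nonneg_right hα (sq_nonneg ‖u (k + 1 + 1) - u (k + 1)‖)
    have h2 : 0 ≤ c / η * ((η ^ 2 + η - 1) * ‖u (k + 1 + 1) - v (k + 1)‖ ^ 2) :=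
      mul_nonneg (by positivity) (mul_nonneg (by linarith) (sq_nonneg _))
    have h3 : c * (‖v (k + 1) - x‖ ^ 2 - ‖u (k + 1 + 1) - v (k + 1)‖ ^ 2 -
          ‖u (k + 1 + 1) - x‖ ^ 2) +
        c * (‖u (k + 1 + 1) - v k‖ ^ 2 - ‖u (k + 1) - v k‖ ^ 2 -
          ‖u (k + 1 + 1) - u (k + 1)‖ ^ 2) =
        1 / (2 * α * (1 - η)) * (‖v (k + 1) - x‖ ^ 2 - ‖v (k + 1 + 1) - x‖ ^ 2) -
        c / η * ‖u (k + 1 + 1) - u (k + 1)‖ ^ 2 -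
        η / (2 * α * (1 - η) ^ 2) * ‖v k - v (k + 1)‖ ^ 2 -
        c / η * ((η ^ 2 + η - 1) * ‖u (k + 1 + 1) - v (k + 1)‖ ^ 2) := by
      rw [hv₃, hv₁, hv₂, hc]
      field_simp
      ring
    linarith
  have hρv : ρ ≤ η / (2 * α * (1 - η) ^ 2) := hρ ▸ min_le_left _ _
  have hρu : ρ ≤ τ / 2 := hρ ▸ (min_le_right _ _).trans (min_le_left _ _)
  have hρp : ρ ≤ (1 - τ * γ) / (2 * γ) :=
    hρ ▸ (min_le_right _ _).trans ((min_le_right _ _).trans (min_le_left _ _))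
  have hρq : ρ ≤ 1 / γ :=
    hρ ▸ (min_le_right _ _).trans ((min_le_right _ _).trans (min_le_right _ _))
  rw [show (1 - τ * γ) / (2 * γ) = 1 / (2 * γ) - τ / 2 by field_simp] at hρp
  have hv' := mul_le_mul_of_nonneg_right hρv (sq_nonneg ‖v k - v (k + 1)‖)
  have hu' := mul_le_mul_of_nonneg_right hρu (sq_nonneg ‖u k - u (k + 1)‖)
  have hp' := mul_le_mul_of_nonneg_right hρp (sq_nonneg ‖p k - p (k + 1)‖)
  have hq' := mul_le_mul_of_nonneg_right hρq (sq_nonneg ‖p (k + 1) - q (k + 1)‖)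
  rw [show k + 2 = k + 1 + 1 from rfl, hΛ, hΛ, norm_sub_rev (u (k + 1)) (u (k + 1 + 1))]
  simp only [inner_sub_left, inner_sub_right] at *
  linarith
end

section
/- Assume the ALAVI setting and that some (u⋆, p⋆) ∈ U × C* solves (MVIS). Then for every k ≥ 1, Λᵏ(u⋆, p⋆) − Λᵏ⁺¹(u⋆, p⋆) ≥ ρ(‖wᵏ⁻¹ − wᵏ‖² + ‖pᵏ − qᵏ‖²); in particular the sequence k ↦ Λᵏ(u⋆, p⋆) is nonincreasing and the sequences (vᵏ), (uᵏ), (pᵏ) are bounded. -/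
open RealInnerProductSpace

section Auxiliary

variable {E F : Type*} [NormedAddCommGroup E] [InnerProductSpace ℝ E]
  [NormedAddCommGroup F] [InnerProductSpace ℝ F]

theorem nonpos_of_forall_le_mul {A B : ℝ} (h : ∀ t : ℝ, 0 < t → t ≤ 1 → A ≤ t * B) : A ≤ 0 := by
  by_contra! hA
  have hB : 0 < B := by linarith [h 1 one_pos le_rfl]
  have ht : 0 < A / (2 * B) := by positivity
  have hAB : A ≤ B := by linarith [h 1 one_pos le_rfl]
  have := h (A / (2 * B)) ht (by rw [div_le_one (by positivity)]; linarith)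
  have h2 : A / (2 * B) * B = A / 2 := by field_simp
  linarith

/-- First-order optimality condition for the proximal step of a convex function. -/
theorem ConvexOn.proximal_le {U : Set E} {f : E → ℝ} (hf : ConvexOn ℝ U f) {α : ℝ} (hα : 0 < α)
    {v z : E} (hz : z ∈ U)
    (hmin : ∀ x ∈ U, f z + ‖z - v‖ ^ 2 / (2 * α) ≤ f x + ‖x - v‖ ^ 2 / (2 * α))
    {x : E} (hx : x ∈ U) : α * (f z - f x) + ⟪z - v, z - x⟫ ≤ 0 := by
  refine nonpos_of_forall_le_mul (B := ‖x - z‖ ^ 2 / 2) fun t ht ht1 => ?_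
  have hmem : (1 - t) • z + t • x ∈ U := hf.1 hz hx (by linarith) ht.le (by ring)
  have hconv := hf.2 hz hx (show 0 ≤ 1 - t by linarith) ht.le (by ring)
  have hm := hmin _ hmem
  have hnorm : ‖(1 - t) • z + t • x - v‖ ^ 2 =
      ‖z - v‖ ^ 2 - 2 * t * ⟪z - v, z - x⟫ + t ^ 2 * ‖x - z‖ ^ 2 := by
    have : (1 - t) • z + t • x - v = (z - v) - t • (z - x) := by module
    rw [this, norm_sub_sq_real, norm_smul, inner_smul_right, mul_pow, Real.norm_eq_abs, sq_abs,
      norm_sub_rev z x]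
    ring
  rw [hnorm] at hm
  simp only [smul_eq_mul] at hconv
  have hm2 := mul_le_mul_of_nonneg_left (hm.trans (add_le_add_left hconv _))
    (show 0 ≤ 2 * α by positivity)
  have e1 : ∀ a b : ℝ, 2 * α * (a + b / (2 * α)) = 2 * α * a + b := fun a b => by field_simp
  rw [e1, e1] at hm2
  refine le_of_mul_le_mul_left ?_ ht
  linarith

theorem norm_le_of_projection {K : Set F} {P : F → F}
    (hP : ∀ x, P x ∈ K ∧ ∀ y ∈ K, ⟪x - P x, y - P x⟫ ≤ 0) (x y : F) :
    ‖P x - P y‖ ≤ ‖x - y‖ := by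
  have h1 := (hP x).2 _ (hP y).1
  have h2 := (hP y).2 _ (hP x).1
  have h3 : ‖P x - P y‖ ^ 2 ≤ ⟪x - y, P x - P y⟫ := by
    have e : ⟪x - y, P x - P y⟫ - ⟪P x - P y, P x - P y⟫ =
        -⟪x - P x, P y - P x⟫ - ⟪y - P y, P x - P y⟫ := by
      simp only [inner_sub_left, inner_sub_right]; ring
    rw [real_inner_self_eq_norm_sq] at e
    linarith
  have h4 := real_inner_le_norm (x - y) (P x - P y)
  by_contra! h
  nlinarith [norm_nonneg (x - y)]

/-- Relation between successive dual iterates `a ↦ b = P (a + s)` and the predictor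
`c = P (b + s)`. -/
theorem dual_step_le {K : Set F} {P : F → F}
    (hP : ∀ x, P x ∈ K ∧ ∀ y ∈ K, ⟪x - P x, y - P x⟫ ≤ 0) {a b c s y : F} (hy : y ∈ K)
    (hb : b = P (a + s)) (hc : c = P (b + s)) :
    (‖a - b‖ ^ 2 + ‖b - y‖ ^ 2 - ‖a - y‖ ^ 2) / 2 + ‖b - c‖ ^ 2 ≤ ⟪s, c - y⟫ := by
  have h1 := (hP (a + s)).2 y hy
  have h2 := (hP (b + s)).2 b (hb ▸ (hP _).1)
  rw [← hb] at h1
  rw [← hc] at h2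
  simp only [← real_inner_self_eq_norm_sq, inner_sub_left, inner_sub_right, inner_add_left] at *
  linarith [real_inner_comm a b, real_inner_comm a y, real_inner_comm b y, real_inner_comm b c]

/-- Lower bound for the proximal terms after relaxation `v' = (1 - η) • u' + η • v`. -/
theorem relaxed_proximal_ge {η : ℝ} (hη0 : 0 < η) (hη : 1 ≤ η + η ^ 2) (hη1 : η < 1)
    {u u' v₀ v v' x : E} (hv : v = (1 - η) • u + η • v₀) (hv' : v' = (1 - η) • u' + η • v) :
    1 / (2 * (1 - η)) * (‖v' - x‖ ^ 2 - ‖v - x‖ ^ 2) + 1 / (2 * η) * ‖u - u'‖ ^ 2 +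
      η / (2 * (1 - η) ^ 2) * ‖v₀ - v‖ ^ 2 ≤ ⟪u' - v, u' - x⟫ + ⟪u - v₀, u - u'⟫ := by
  have hη2 : 0 < 1 - η := by linarith
  have a1 : ‖v' - x‖ ^ 2 - ‖v - x‖ ^ 2 =
      (1 - η) * (2 * ⟪u' - v, u' - x⟫ - (1 + η) * ‖u' - v‖ ^ 2) := by
    have e1 : v' - x = (u' - x) - η • (u' - v) := by rw [hv']; module
    have e2 : v - x = (u' - x) - (u' - v) := by module
    rw [e1, e2, norm_sub_sq_real (u' - x), norm_sub_sq_real (u' - x), norm_smul, inner_smul_right, mul_pow,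
      Real.norm_eq_abs, sq_abs, real_inner_comm (u' - x)]
    ring
  have a2 : ‖v₀ - v‖ ^ 2 = (1 - η) ^ 2 * ‖u - v₀‖ ^ 2 := by
    have : v₀ - v = -((1 - η) • (u - v₀)) := by rw [hv]; module
    rw [this, norm_neg, norm_smul, mul_pow, Real.norm_eq_abs, sq_abs]
  have a3 : ‖u' - v‖ ^ 2 = η ^ 2 * ‖u - v₀‖ ^ 2 - 2 * η * ⟪u - v₀, u - u'⟫ + ‖u - u'‖ ^ 2 := by
    have : u' - v = η • (u - v₀) - (u - u') := by rw [hv]; module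
    rw [this, norm_sub_sq_real, norm_smul, inner_smul_left, mul_pow, Real.norm_eq_abs, sq_abs]
    simp; ring
  rw [a1, a2]
  have e1 : 1 / (2 * (1 - η)) * ((1 - η) * (2 * ⟪u' - v, u' - x⟫ - (1 + η) * ‖u' - v‖ ^ 2)) =
      ⟪u' - v, u' - x⟫ - (1 + η) / 2 * ‖u' - v‖ ^ 2 := by field_simp
  have e2 : η / (2 * (1 - η) ^ 2) * ((1 - η) ^ 2 * ‖u - v₀‖ ^ 2) = η / 2 * ‖u - v₀‖ ^ 2 := by
    field_simp
  have e3 : 1 / (2 * η) * ‖u - u'‖ ^ 2 =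
      1 / (2 * η) * ‖u' - v‖ ^ 2 - η / 2 * ‖u - v₀‖ ^ 2 + ⟪u - v₀, u - u'⟫ := by
    rw [a3]; field_simp; ring
  have e4 : 1 / (2 * η) ≤ (1 + η) / 2 := by
    rw [div_le_div_iff₀ (by positivity) two_pos]; nlinarith
  rw [e1, e2, e3]
  nlinarith [mul_le_mul_of_nonneg_right e4 (sq_nonneg ‖u' - v‖)]

theorem neg_inner_le_mul {a b : F} {A B c : ℝ}
    (ha : ‖a‖ ≤ A) (hb : ‖b‖ ≤ c * B) (hA : 0 ≤ A) : -⟪a, b⟫ ≤ c * (A * B) := by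
  have h1 := (neg_le_abs _).trans (abs_real_inner_le_norm a b)
  have h2 := mul_le_mul ha hb (norm_nonneg _) hA
  linarith

end Auxiliary

theorem stmt13 (n m : ℕ)
    (U : Set (EuclideanSpace ℝ (Fin n)))
    (hUne : U.Nonempty) (hUcl : IsClosed U) (hUcx : Convex ℝ U)
    (C : Set (EuclideanSpace ℝ (Fin m)))
    (hCne : C.Nonempty) (hCcl : IsClosed C) (hCcx : Convex ℝ C)
    (hCcone : ∀ c ∈ C, ∀ t : ℝ, 0 < t → t • c ∈ C)
    (Cstar : Set (EuclideanSpace ℝ (Fin m)))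
    (hCstar : Cstar = {p | ∀ c ∈ C, 0 ≤ ⟪p, c⟫})
    (G : EuclideanSpace ℝ (Fin n) → EuclideanSpace ℝ (Fin n)) (hG : Continuous G)
    (J : EuclideanSpace ℝ (Fin n) → ℝ) (hJ : ConvexOn ℝ Set.univ J)
    (Θ : EuclideanSpace ℝ (Fin n) → EuclideanSpace ℝ (Fin m)) (hΘc : Continuous Θ)
    (hΘcx : ∀ x y : EuclideanSpace ℝ (Fin n), ∀ a : ℝ, a ∈ Set.Icc (0 : ℝ) 1 →
      Θ (a • x + (1 - a) • y) - a • Θ x - (1 - a) • Θ y ∈ -C)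
    (Γ : Set (EuclideanSpace ℝ (Fin n)))
    (hΓ : Γ = {x ∈ U | Θ x ∈ -C})
    (Pi : EuclideanSpace ℝ (Fin m) → EuclideanSpace ℝ (Fin m))
    (hPi : ∀ x, Pi x ∈ Cstar ∧ ∀ y ∈ Cstar, ⟪x - Pi x, y - Pi x⟫ ≤ 0)
    (L τ η γ α : ℝ) (hL : 0 ≤ L) (hτ : 0 < τ)
    (hGLip : ∀ x ∈ U, ∀ y ∈ U, ‖G x - G y‖ ≤ L * ‖x - y‖)
    (hΘLip : ∀ x y : EuclideanSpace ℝ (Fin n), ‖Θ x - Θ y‖ ≤ τ * ‖x - y‖)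
    (hη₁ : (Real.sqrt 5 - 1) / 2 ≤ η) (hη₂ : η < 1)
    (hγ₁ : 0 < γ) (hγ₂ : γ < 1 / τ)
    (hα₁ : 0 < α) (hα₂ : α ≤ 1 / (2 * (γ * τ ^ 2 + L + τ) * η))
    (u v : ℕ → EuclideanSpace ℝ (Fin n)) (p q : ℕ → EuclideanSpace ℝ (Fin m))
    (hu0 : u 0 ∈ U)
    (hq : ∀ k, q k = Pi (p k + γ • Θ (u k)))
    (huU : ∀ k, u (k + 1) ∈ U)
    (humin : ∀ k, ∀ x ∈ U,
      ⟪G (u k), u (k + 1)⟫ + J (u (k + 1)) + ⟪q k, Θ (u (k + 1))⟫ +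
          ‖u (k + 1) - v k‖ ^ 2 / (2 * α) ≤
        ⟪G (u k), x⟫ + J x + ⟪q k, Θ x⟫ + ‖x - v k‖ ^ 2 / (2 * α))
    (hp : ∀ k, p (k + 1) = Pi (p k + γ • Θ (u (k + 1))))
    (hv : ∀ k, v (k + 1) = (1 - η) • u (k + 1) + η • v k)
    (ρ : ℝ)
    (hρ : ρ = min (η / (2 * α * (1 - η) ^ 2))
      (min (τ / 2) (min ((1 - τ * γ) / (2 * γ)) (1 / γ))))
    (Λ : ℕ → EuclideanSpace ℝ (Fin n) → EuclideanSpace ℝ (Fin m) → ℝ)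
    (hΛ : ∀ k x y, Λ (k + 1) x y =
      (1 / (2 * α * (1 - η))) * ‖v (k + 1) - x‖ ^ 2 +
      ((γ * τ ^ 2 + L + τ) / 2) * ‖u k - u (k + 1)‖ ^ 2 +
      (1 / (2 * γ)) * ‖p k - y‖ ^ 2)
    (hΓne : Γ.Nonempty)
    (ustar : EuclideanSpace ℝ (Fin n)) (hustar : ustar ∈ U)
    (pstar : EuclideanSpace ℝ (Fin m)) (hpstar : pstar ∈ Cstar)
    (hMVIS1 : ∀ x ∈ U,
      0 ≤ ⟪G x, x - ustar⟫ + J x - J ustar + ⟪pstar, Θ x - Θ ustar⟫)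
    (hMVIS2 : ∀ y ∈ Cstar, ⟪Θ ustar, y - pstar⟫ ≤ 0) :
    (∀ k : ℕ,
      ρ * ((‖v k - v (k + 1)‖ ^ 2 + ‖u k - u (k + 1)‖ ^ 2 + ‖p k - p (k + 1)‖ ^ 2) +
        ‖p (k + 1) - q (k + 1)‖ ^ 2) ≤
      Λ (k + 1) ustar pstar - Λ (k + 2) ustar pstar) ∧
    (∀ k : ℕ, Λ (k + 2) ustar pstar ≤ Λ (k + 1) ustar pstar) ∧
    (∃ M : ℝ, ∀ k : ℕ, ‖v k‖ ≤ M ∧ ‖u k‖ ≤ M ∧ ‖p k‖ ≤ M) := by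
  have huUall : ∀ k, u k ∈ U := fun k => by cases k with
    | zero => exact hu0
    | succ k => exact huU k
  have hη0 : 0 < η := by
    have : (1 : ℝ) < Real.sqrt 5 := by
      rw [Real.lt_sqrt] <;> norm_num
    linarith
  have hηg : 1 ≤ η + η ^ 2 := by
    have h5 : Real.sqrt 5 ^ 2 = 5 := Real.sq_sqrt (by norm_num)
    nlinarith [Real.sqrt_nonneg 5]
  have hη3 : 0 < 1 - η := by linarith
  have hγτ : τ * γ < 1 := by rw [lt_div_iff₀ hτ] at hγ₂; linarith
  have hS : 0 < γ * τ ^ 2 + L + τ := by positivity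
  have hαS : γ * τ ^ 2 + L + τ ≤ 1 / α * (1 / (2 * η)) := by
    rw [le_div_iff₀ (by positivity)] at hα₂
    rw [div_mul_div_comm, le_div_iff₀ (by positivity)]
    linarith
  have hqC : ∀ k, q k ∈ Cstar := fun k => hq k ▸ (hPi _).1
  have hconv : ∀ k, ConvexOn ℝ U fun x => ⟪G (u k), x⟫ + J x + ⟪q k, Θ x⟫ := by
    intro k
    refine ⟨hUcx, fun x _ y _ a b ha hb hab => ?_⟩
    obtain rfl : b = 1 - a := by linarith
    have h1 := hJ.2 (Set.mem_univ x) (Set.mem_univ y) ha hb hab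
    have h2 := hΘcx x y a ⟨ha, by linarith⟩
    have hqk := hqC k
    rw [hCstar] at hqk
    have h3 := hqk _ h2
    simp only [inner_neg_right, inner_sub_right, inner_add_right, inner_smul_right,
      smul_eq_mul] at h1 h3 ⊢
    linarith
  have hprox : ∀ k, ∀ x ∈ U,
      (⟪G (u k), u (k + 1)⟫ + J (u (k + 1)) + ⟪q k, Θ (u (k + 1))⟫) -
        (⟪G (u k), x⟫ + J x + ⟪q k, Θ x⟫) + 1 / α * ⟪u (k + 1) - v k, u (k + 1) - x⟫ ≤ 0 := by
    intro k x hx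
    have h := (hconv k).proximal_le hα₁ (huU k) (humin k) hx
    refine le_of_mul_le_mul_left ?_ hα₁
    rw [mul_add, ← mul_assoc, mul_one_div_cancel hα₁.ne', one_mul, mul_zero]
    exact h
  have hdec : ∀ k : ℕ,
      ρ * ((‖v k - v (k + 1)‖ ^ 2 + ‖u k - u (k + 1)‖ ^ 2 + ‖p k - p (k + 1)‖ ^ 2) +
        ‖p (k + 1) - q (k + 1)‖ ^ 2) ≤
      Λ (k + 1) ustar pstar - Λ (k + 2) ustar pstar := by
    intro k
    have ha := hprox (k + 1) ustar hustar
    have hb := hprox k (u (k + 2)) (huU _)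
    have hc := hMVIS1 (u (k + 1)) (huU k)
    have hd := hMVIS2 (q (k + 1)) (hqC _)
    have hdual := dual_step_le hPi hpstar (hp k) (hq (k + 1))
    have hrel := relaxed_proximal_ge hη0 hηg hη₂ (x := ustar) (hv k) (hv (k + 1))
    have hrel' := mul_le_mul_of_nonneg_left hrel (show 0 ≤ 1 / α by positivity)
    have hdual' := mul_le_mul_of_nonneg_left hdual (show 0 ≤ 1 / γ by positivity)
    rw [inner_smul_left, ← mul_assoc] at hdual'
    have hγ' : 1 / γ * (starRingEnd ℝ) γ = 1 := by
      simp [hγ₁.ne']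
    rw [hγ', one_mul] at hdual'
    have hqq : ‖q (k + 1) - q k‖ ≤
        ‖p k - p (k + 1)‖ + γ * τ * ‖u k - u (k + 1)‖ := by
      rw [hq, hq]
      refine (norm_le_of_projection hPi _ _).trans ?_
      have e : p (k + 1) + γ • Θ (u (k + 1)) - (p k + γ • Θ (u k)) =
        (p (k + 1) - p k) + γ • (Θ (u (k + 1)) - Θ (u k)) := by module
      rw [e]
      refine (norm_add_le _ _).trans ?_
      rw [norm_sub_rev (p (k + 1)), norm_smul, Real.norm_of_nonneg hγ₁.le, mul_assoc,
        norm_sub_rev (u k)]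
      gcongr
      exact hΘLip _ _
    have hI1 := neg_inner_le_mul hqq (hΘLip (u (k + 2)) (u (k + 1))) (by positivity)
    have hI2 := neg_inner_le_mul (norm_sub_rev (u (k + 2)) (u (k + 1))).le
      (hGLip _ (huUall (k + 1)) _ (huUall k)) (norm_nonneg _)
    rw [norm_sub_rev (u (k + 2))] at hI1
    rw [norm_sub_rev (u (k + 1)) (u k)] at hI2
    have hαS' := mul_le_mul_of_nonneg_right hαS (sq_nonneg ‖u (k + 1) - u (k + 2)‖)
    have hρ1 : ρ ≤ η / (2 * α * (1 - η) ^ 2) := by simp [hρ]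
    have hρ2 : ρ ≤ τ / 2 := by simp [hρ]
    have hρ3 : ρ ≤ (1 - τ * γ) / (2 * γ) := by simp [hρ]
    have hρ4 : ρ ≤ 1 / γ := by simp [hρ]
    have m1 := mul_le_mul_of_nonneg_right hρ1 (sq_nonneg ‖v k - v (k + 1)‖)
    have m2 := mul_le_mul_of_nonneg_right hρ2 (sq_nonneg ‖u k - u (k + 1)‖)
    have m3 := mul_le_mul_of_nonneg_right hρ3 (sq_nonneg ‖p k - p (k + 1)‖)
    have m4 := mul_le_mul_of_nonneg_right hρ4 (sq_nonneg ‖p (k + 1) - q (k + 1)‖)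
    have c1 : η / (2 * α * (1 - η) ^ 2) = 1 / α * (η / (2 * (1 - η) ^ 2)) := by field_simp
    have c3 : (1 - τ * γ) / (2 * γ) = 1 / γ / 2 - τ / 2 := by field_simp
    have c4 : 1 / (2 * α * (1 - η)) = 1 / α * (1 / (2 * (1 - η))) := by field_simp
    have c5 : 1 / (2 * γ) = 1 / γ / 2 := by field_simp
    rw [hΛ, hΛ (k + 1), c4, c5]
    rw [c1] at m1
    rw [c3] at m3
    have s1 := mul_nonneg hτ.le (sq_nonneg (‖p k - p (k + 1)‖ - ‖u (k + 1) - u (k + 2)‖))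
    have s2 := mul_nonneg (show 0 ≤ γ * τ ^ 2 + L by positivity)
      (sq_nonneg (‖u k - u (k + 1)‖ - ‖u (k + 1) - u (k + 2)‖))
    have key : 1 / α * (⟪u (k + 2) - v (k + 1), u (k + 2) - ustar⟫ +
        ⟪u (k + 1) - v k, u (k + 1) - u (k + 2)⟫) + ⟪Θ (u (k + 1)), q (k + 1) - pstar⟫ ≤
        -⟪q (k + 1) - q k, Θ (u (k + 2)) - Θ (u (k + 1))⟫ -
          ⟪u (k + 2) - u (k + 1), G (u (k + 1)) - G (u k)⟫ := by
      rw [mul_add]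
      generalize 1 / α * ⟪u (k + 2) - v (k + 1), u (k + 2) - ustar⟫ = X at *
      generalize 1 / α * ⟪u (k + 1) - v k, u (k + 1) - u (k + 2)⟫ = Y at *
      simp only [real_inner_comm (G _), real_inner_comm (Θ _), inner_sub_right] at ha hb hc hd ⊢
      linarith
    have hXY := hrel'.trans (le_sub_iff_add_le.mpr key)
    linarith only [hXY, hdual', hI1, hI2, hαS', m1, m2, m3, m4, s1, s2]
  have hρ0 : 0 ≤ ρ := by
    rw [hρ]
    have : 0 ≤ 1 - τ * γ := by linarith
    refine le_min ?_ (le_min ?_ (le_min ?_ ?_)) <;> positivity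
  have hmono : ∀ k : ℕ, Λ (k + 2) ustar pstar ≤ Λ (k + 1) ustar pstar := fun k => by
    have : 0 ≤ ρ * ((‖v k - v (k + 1)‖ ^ 2 + ‖u k - u (k + 1)‖ ^ 2 + ‖p k - p (k + 1)‖ ^ 2) +
        ‖p (k + 1) - q (k + 1)‖ ^ 2) := by positivity
    linarith [hdec k]
  refine ⟨hdec, hmono, ?_⟩
  have hanti : ∀ k, Λ (k + 1) ustar pstar ≤ Λ 1 ustar pstar := fun k =>
    (antitone_nat_of_succ_le (f := fun k => Λ (k + 1) ustar pstar) hmono) (Nat.zero_le k)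
  have hβ₁ : 0 < 1 / (2 * α * (1 - η)) := by positivity
  have hβ₃ : 0 < 1 / (2 * γ) := by positivity
  have hvb : ∀ k, ‖v (k + 1)‖ ≤
      Real.sqrt (Λ 1 ustar pstar / (1 / (2 * α * (1 - η)))) + ‖ustar‖ := fun k => by
    refine (norm_le_norm_sub_add _ ustar).trans (add_le_add_left (Real.le_sqrt_of_sq_le ?_) _)
    rw [le_div_iff₀ hβ₁, mul_comm]
    refine le_trans ?_ (hanti k)
    rw [hΛ, add_assoc]
    exact le_add_of_nonneg_right (by positivity)
  have hpb : ∀ k, ‖p k‖ ≤ Real.sqrt (Λ 1 ustar pstar / (1 / (2 * γ))) + ‖pstar‖ := fun k => by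
    refine (norm_le_norm_sub_add _ pstar).trans (add_le_add_left (Real.le_sqrt_of_sq_le ?_) _)
    rw [le_div_iff₀ hβ₃, mul_comm]
    refine le_trans ?_ (hanti k)
    rw [hΛ]
    exact le_add_of_nonneg_left (by positivity)
  generalize Real.sqrt (Λ 1 ustar pstar / (1 / (2 * α * (1 - η)))) + ‖ustar‖ = A at hvb
  generalize Real.sqrt (Λ 1 ustar pstar / (1 / (2 * γ))) + ‖pstar‖ = B at hpb
  have hvb' : ∀ k, ‖v k‖ ≤ max A ‖v 0‖ := fun k => by cases k with
    | zero => exact le_max_right _ _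
    | succ k => exact (hvb k).trans (le_max_left _ _)
  generalize max A ‖v 0‖ = A' at hvb'
  have hub : ∀ k, ‖u (k + 1)‖ ≤ (1 - η)⁻¹ * (A' + η * A') := fun k => by
    have e : u (k + 1) = (1 - η)⁻¹ • (v (k + 1) - η • v k) := by
      rw [hv, add_sub_cancel_right, smul_smul, inv_mul_cancel₀ hη3.ne', one_smul]
    rw [e, norm_smul, Real.norm_of_nonneg (by positivity)]
    gcongr
    refine (norm_sub_le _ _).trans ?_
    rw [norm_smul, Real.norm_of_nonneg hη0.le]
    gcongr
    · exact hvb' _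
    · exact hvb' _
  refine ⟨max A' (max (max ((1 - η)⁻¹ * (A' + η * A')) ‖u 0‖) B), fun k => ⟨?_, ?_, ?_⟩⟩
  · exact (hvb' k).trans (le_max_left _ _)
  · refine le_trans ?_ ((le_max_left _ _).trans (le_max_right _ _))
    cases k with
    | zero => exact le_max_right _ _
    | succ k => exact (hub k).trans (le_max_left _ _)
  · exact (hpb k).trans ((le_max_right _ _).trans (le_max_right _ _))
end

section
/- Assume the ALAVI setting and that some (u⋆, p⋆) ∈ U × C* solves (MVIS). Then liminf_{k→∞} √k · ‖wᵏ⁻¹ − wᵏ‖ = 0, where ‖wᵏ⁻¹ − wᵏ‖² = ‖vᵏ⁻¹ − vᵏ‖² + ‖uᵏ⁻¹ − uᵏ‖² + ‖pᵏ⁻¹ − pᵏ‖²; that is, the successive-iterate displacement ‖wᵏ⁻¹ − wᵏ‖ is o(1/√k) along a subsequence. -/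
open RealInnerProductSpace

section InnerProductSpace

variable {E F : Type*} [NormedAddCommGroup E] [InnerProductSpace ℝ E]
  [NormedAddCommGroup F] [InnerProductSpace ℝ F]

/-- The variational inequality satisfied by a proximal point of a convex function. -/
theorem ConvexOn.le_add_inner_of_prox {U : Set E} {f : E → ℝ} (hf : ConvexOn ℝ U f)
    {α : ℝ} (hα : 0 < α) {x z : E} (hx : x ∈ U)
    (hmin : ∀ y ∈ U, f x + ‖x - z‖ ^ 2 / (2 * α) ≤ f y + ‖y - z‖ ^ 2 / (2 * α))
    {y : E} (hy : y ∈ U) : f x ≤ f y + ⟪x - z, y - x⟫ / α := by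
  have key : ∀ t : ℝ, 0 < t → t ≤ 1 →
      f x ≤ f y + ⟪x - z, y - x⟫ / α + t * (‖y - x‖ ^ 2 / (2 * α)) := by
    intro t ht ht1
    have h1 := hmin _ (hf.1 hx hy (sub_nonneg.2 ht1) ht.le (by ring))
    have h2 := hf.2 hx hy (sub_nonneg.2 ht1) ht.le (by ring)
    have h3 : ‖(1 - t) • x + t • y - z‖ ^ 2 =
        ‖x - z‖ ^ 2 + 2 * (t * ⟪x - z, y - x⟫) + t ^ 2 * ‖y - x‖ ^ 2 := by
      rw [show (1 - t) • x + t • y - z = (x - z) + t • (y - x) by module, norm_add_sq_real,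
        real_inner_smul_right, norm_smul, mul_pow, Real.norm_eq_abs, sq_abs]
    rw [h3] at h1
    simp only [smul_eq_mul] at h2
    have h4 : (‖x - z‖ ^ 2 + 2 * (t * ⟪x - z, y - x⟫) + t ^ 2 * ‖y - x‖ ^ 2) / (2 * α) =
        ‖x - z‖ ^ 2 / (2 * α) +
          t * (⟪x - z, y - x⟫ / α + t * (‖y - x‖ ^ 2 / (2 * α))) := by
      field_simp
      ring
    rw [h4] at h1
    refine le_of_mul_le_mul_left (a := t) ?_ ht
    linarith
  have hlim : Filter.Tendsto
      (fun t : ℝ => f y + ⟪x - z, y - x⟫ / α + t * (‖y - x‖ ^ 2 / (2 * α)))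
      (nhdsWithin 0 (Set.Ioi 0)) (nhds (f y + ⟪x - z, y - x⟫ / α)) := by
    have : Continuous
        (fun t : ℝ => f y + ⟪x - z, y - x⟫ / α + t * (‖y - x‖ ^ 2 / (2 * α))) := by fun_prop
    simpa using (this.tendsto 0).mono_left nhdsWithin_le_nhds
  refine ge_of_tendsto hlim ?_
  filter_upwards [Ioc_mem_nhdsGT (zero_lt_one' ℝ)] with t ht using key t ht.1 ht.2

/-- Two points satisfying the obtuse-angle criterion for projections are no further apart than
the points being projected. -/
theorem norm_sub_le_of_inner_sub_nonpos {a b x y : F} (ha : ⟪a - x, y - x⟫ ≤ 0)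
    (hb : ⟪b - y, x - y⟫ ≤ 0) : ‖x - y‖ ≤ ‖a - b‖ := by
  have h : ‖x - y‖ ^ 2 ≤ ⟪a - b, x - y⟫ := by
    rw [← real_inner_self_eq_norm_sq]
    simp only [inner_sub_left, inner_sub_right] at *
    linarith
  have h' := h.trans (real_inner_le_norm _ _)
  by_contra! hlt
  nlinarith [norm_nonneg (a - b), norm_nonneg (x - y)]

/-- The three-point inequality for a projection step from `p` in direction `d`. -/
theorem two_mul_inner_le_of_inner_sub_nonpos {p p' d y : F}
    (h : ⟪p + d - p', y - p'⟫ ≤ 0) :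
    2 * ⟪d, y - p'⟫ ≤ ‖p - y‖ ^ 2 - ‖p' - y‖ ^ 2 - ‖p' - p‖ ^ 2 := by
  simp only [← real_inner_self_eq_norm_sq, inner_sub_left, inner_sub_right, inner_add_left] at *
  linarith [real_inner_comm p y, real_inner_comm p' y, real_inner_comm p p']

/-- The golden-ratio inequality for the averaged anchor `(1 - η) • y + η • w`. -/
theorem goldenRatio_inner_le {η : ℝ} (hη : 0 < η) (hη₁ : η < 1) (hgold : 1 ≤ η ^ 2 + η)
    (s x y w : E) :
    2 * (⟪y - w, s - y⟫ + ⟪x - w, y - x⟫ / η) ≤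
      (‖w - s‖ ^ 2 - ‖(1 - η) • y + η • w - s‖ ^ 2) / (1 - η)
        - ‖x - w‖ ^ 2 / η - ‖y - x‖ ^ 2 / η := by
  obtain ⟨a, rfl⟩ : ∃ a, y = w + a := ⟨y - w, by abel⟩
  obtain ⟨b, rfl⟩ : ∃ b, x = w + b := ⟨x - w, by abel⟩
  obtain ⟨d, rfl⟩ : ∃ d, s = w + d := ⟨s - w, by abel⟩
  have hη₁' : 1 - η ≠ 0 := by linarith
  have e1 : (‖w - (w + d)‖ ^ 2 - ‖(1 - η) • (w + a) + η • w - (w + d)‖ ^ 2) / (1 - η) =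
      2 * ⟪a, d⟫ - (1 - η) * ‖a‖ ^ 2 := by
    rw [show (1 - η) • (w + a) + η • w - (w + d) = (1 - η) • a - d by module,
      show w - (w + d) = -d by abel, norm_neg, norm_sub_sq_real, real_inner_smul_left, norm_smul,
      mul_pow, Real.norm_eq_abs, sq_abs]
    field_simp
    ring
  have e2 : ‖w + a - (w + b)‖ ^ 2 = ‖a‖ ^ 2 - 2 * ⟪b, a⟫ + ‖b‖ ^ 2 := by
    rw [add_sub_add_left_eq_sub, norm_sub_sq_real, real_inner_comm]
  rw [e1, e2]
  simp only [add_sub_cancel_left, add_sub_add_left_eq_sub, inner_sub_right,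
    real_inner_self_eq_norm_sq]
  have h : ‖a‖ ^ 2 / η ≤ (1 + η) * ‖a‖ ^ 2 := by
    rw [div_le_iff₀ hη]
    nlinarith [sq_nonneg ‖a‖]
  have e3 : 2 * (⟪a, d⟫ - ‖a‖ ^ 2 + (⟪b, a⟫ - ‖b‖ ^ 2) / η) =
      2 * ⟪a, d⟫ - 2 * ‖a‖ ^ 2 + (2 * ⟪b, a⟫ / η - 2 * (‖b‖ ^ 2 / η)) := by ring
  have e4 : (‖a‖ ^ 2 - 2 * ⟪b, a⟫ + ‖b‖ ^ 2) / η =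
      ‖a‖ ^ 2 / η - 2 * ⟪b, a⟫ / η + ‖b‖ ^ 2 / η := by ring
  rw [e3, e4]
  linarith

end InnerProductSpace

/-- A nonnegative sequence dominated by the decrements of a nonnegative sequence is summable. -/
theorem summable_of_le_sub_succ {a e : ℕ → ℝ} (ha : ∀ k, 0 ≤ a k) (he : ∀ k, 0 ≤ e k)
    (h : ∀ k, a k ≤ e k - e (k + 1)) : Summable a := by
  refine summable_of_sum_range_le (c := e 0) ha fun k => ?_
  have h1 := Finset.sum_le_sum fun i (_ : i ∈ Finset.range k) => h i
  rw [Finset.sum_range_sub'] at h1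
  linarith [he k]

/-- A nonnegative summable sequence is `o(1 / k)` along a subsequence. -/
theorem liminf_sqrt_mul_sqrt_eq_zero {a : ℕ → ℝ} (ha : ∀ k, 0 ≤ a k) (hs : Summable a) :
    Filter.liminf (fun k : ℕ => Real.sqrt k * Real.sqrt (a k)) Filter.atTop = 0 := by
  rw [Filter.liminf_eq]
  refine IsGreatest.csSup_eq ⟨Filter.Eventually.of_forall fun k => by positivity, ?_⟩
  intro b hb
  by_contra! hb0
  refine Real.not_summable_natCast_inv ?_
  refine Summable.of_norm_bounded_eventually_nat (hs.mul_left (b ^ 2)⁻¹) ?_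
  filter_upwards [hb, Filter.eventually_gt_atTop 0] with k hk hk0
  have hk0' : (0 : ℝ) < k := by exact_mod_cast hk0
  have h1 : b ^ 2 ≤ k * a k := by
    have := pow_le_pow_left₀ hb0.le hk 2
    rwa [mul_pow, Real.sq_sqrt hk0'.le, Real.sq_sqrt (ha k)] at this
  rw [Real.norm_of_nonneg (by positivity), ← div_eq_inv_mul, le_div_iff₀ (by positivity),
    inv_mul_le_iff₀ hk0']
  exact h1

theorem stmt15 (n m : ℕ)
    (U : Set (EuclideanSpace ℝ (Fin n)))
    (hUne : U.Nonempty) (hUcl : IsClosed U) (hUcx : Convex ℝ U)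
    (C : Set (EuclideanSpace ℝ (Fin m)))
    (hCne : C.Nonempty) (hCcl : IsClosed C) (hCcx : Convex ℝ C)
    (hCcone : ∀ c ∈ C, ∀ t : ℝ, 0 < t → t • c ∈ C)
    (Cstar : Set (EuclideanSpace ℝ (Fin m)))
    (hCstar : Cstar = {p | ∀ c ∈ C, 0 ≤ ⟪p, c⟫})
    (G : EuclideanSpace ℝ (Fin n) → EuclideanSpace ℝ (Fin n)) (hG : Continuous G)
    (J : EuclideanSpace ℝ (Fin n) → ℝ) (hJ : ConvexOn ℝ Set.univ J)
    (Θ : EuclideanSpace ℝ (Fin n) → EuclideanSpace ℝ (Fin m)) (hΘc : Continuous Θ)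
    (hΘcx : ∀ x y : EuclideanSpace ℝ (Fin n), ∀ a : ℝ, a ∈ Set.Icc (0 : ℝ) 1 →
      Θ (a • x + (1 - a) • y) - a • Θ x - (1 - a) • Θ y ∈ -C)
    (Pi : EuclideanSpace ℝ (Fin m) → EuclideanSpace ℝ (Fin m))
    (hPi : ∀ x, Pi x ∈ Cstar ∧ ∀ y ∈ Cstar, ⟪x - Pi x, y - Pi x⟫ ≤ 0)
    (L τ η γ α : ℝ) (hL : 0 ≤ L) (hτ : 0 < τ)
    (hGLip : ∀ x ∈ U, ∀ y ∈ U, ‖G x - G y‖ ≤ L * ‖x - y‖)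
    (hΘLip : ∀ x y : EuclideanSpace ℝ (Fin n), ‖Θ x - Θ y‖ ≤ τ * ‖x - y‖)
    (hη₁ : (Real.sqrt 5 - 1) / 2 ≤ η) (hη₂ : η < 1)
    (hγ₁ : 0 < γ) (hγ₂ : γ < 1 / τ)
    (hα₁ : 0 < α) (hα₂ : α ≤ 1 / (2 * (γ * τ ^ 2 + L + τ) * η))
    (u v : ℕ → EuclideanSpace ℝ (Fin n)) (p q : ℕ → EuclideanSpace ℝ (Fin m))
    (hu0 : u 0 ∈ U)
    (hq : ∀ k, q k = Pi (p k + γ • Θ (u k)))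
    (huU : ∀ k, u (k + 1) ∈ U)
    (humin : ∀ k, ∀ x ∈ U,
      ⟪G (u k), u (k + 1)⟫ + J (u (k + 1)) + ⟪q k, Θ (u (k + 1))⟫ +
          ‖u (k + 1) - v k‖ ^ 2 / (2 * α) ≤
        ⟪G (u k), x⟫ + J x + ⟪q k, Θ x⟫ + ‖x - v k‖ ^ 2 / (2 * α))
    (hp : ∀ k, p (k + 1) = Pi (p k + γ • Θ (u (k + 1))))
    (hv : ∀ k, v (k + 1) = (1 - η) • u (k + 1) + η • v k)
    (ρ : ℝ)
    (ustar : EuclideanSpace ℝ (Fin n)) (hustar : ustar ∈ U)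
    (pstar : EuclideanSpace ℝ (Fin m)) (hpstar : pstar ∈ Cstar)
    (hMVIS1 : ∀ x ∈ U,
      0 ≤ ⟪G x, x - ustar⟫ + J x - J ustar + ⟪pstar, Θ x - Θ ustar⟫)
    (hMVIS2 : ∀ y ∈ Cstar, ⟪Θ ustar, y - pstar⟫ ≤ 0) :
    Filter.liminf (fun k : ℕ => Real.sqrt k *
      Real.sqrt (‖v (k - 1) - v k‖ ^ 2 + ‖u (k - 1) - u k‖ ^ 2 +
        ‖p (k - 1) - p k‖ ^ 2)) Filter.atTop = 0 := by
  have hη : 0 < η := by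
    have h5 : (1 : ℝ) < Real.sqrt 5 := by
      rw [Real.lt_sqrt (by norm_num)]
      norm_num
    linarith
  have hgold : 1 ≤ η ^ 2 + η := by
    nlinarith [Real.sq_sqrt (show (0 : ℝ) ≤ 5 by norm_num), Real.sqrt_nonneg 5]
  have hη' : 0 < 1 - η := by linarith
  have hpmem : ∀ k, p (k + 1) ∈ Cstar := fun k => hp k ▸ (hPi _).1
  have hqmem : ∀ k, q k ∈ Cstar := fun k => hq k ▸ (hPi _).1
  have humem : ∀ k, u k ∈ U := fun k => by
    cases k with
    | zero => exact hu0
    | succ k => exact huU k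
  have hcvx : ∀ k, ConvexOn ℝ U fun x => ⟪G (u k), x⟫ + J x + ⟪q k, Θ x⟫ := by
    intro k
    refine ((((innerSL ℝ (G (u k))).toLinearMap.convexOn hUcx).add
      (hJ.subset (Set.subset_univ U) hUcx)).add ⟨hUcx, fun x _ y _ a b ha hb hab => ?_⟩)
    obtain rfl : b = 1 - a := by linarith
    have hmem := hΘcx x y a ⟨ha, by linarith⟩
    have hpos := (hCstar ▸ hqmem k : q k ∈ {p | ∀ c ∈ C, 0 ≤ ⟪p, c⟫}) _ (Set.mem_neg.1 hmem)
    simp only [inner_neg_right, inner_sub_right, real_inner_smul_right] at hpos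
    simp only [smul_eq_mul]
    linarith
  have hprox : ∀ k, ∀ y ∈ U,
      ⟪G (u k), u (k + 1)⟫ + J (u (k + 1)) + ⟪q k, Θ (u (k + 1))⟫ ≤
        ⟪G (u k), y⟫ + J y + ⟪q k, Θ y⟫ + ⟪u (k + 1) - v k, y - u (k + 1)⟫ / α :=
    fun k y hy => (hcvx k).le_add_inner_of_prox hα₁ (huU k) (humin k) hy
  have hstep : γ * τ ^ 2 + L + τ ≤ 1 / (2 * α * η) := by
    rw [le_div_iff₀ (by positivity)] at hα₂ ⊢
    linarith
  have hτγ : τ / 2 ≤ 1 / γ := by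
    rw [lt_div_iff₀ hτ] at hγ₂
    rw [le_div_iff₀ hγ₁]
    linarith
  set κ : ℝ := η / (2 * α * (1 - η) ^ 2) with hκ
  have hκ0 : 0 < κ := by positivity
  let e : ℕ → ℝ := fun k => ‖v (k + 1) - ustar‖ ^ 2 / (2 * α * (1 - η)) +
    ‖p k - pstar‖ ^ 2 / (2 * γ) + (γ * τ ^ 2 + L + τ) / 2 * ‖u (k + 1) - u k‖ ^ 2
  let d : ℕ → ℝ := fun k => κ * ‖v k - v (k + 1)‖ ^ 2 + τ / 2 * ‖u k - u (k + 1)‖ ^ 2 +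
    1 / (2 * γ) * ‖p k - p (k + 1)‖ ^ 2
  have hdescent : ∀ k, d k ≤ e k - e (k + 1) := by
    intro k
    have hopt := hprox (k + 1) ustar hustar
    have hopt' := hprox k (u (k + 2)) (huU (k + 1))
    have hminty := hMVIS1 (u (k + 1)) (huU k)
    have hslack := hMVIS2 (q (k + 1)) (hqmem (k + 1))
    have hdual : 2 * ⟪γ • Θ (u (k + 1)), pstar - p (k + 1)⟫ ≤
        ‖p k - pstar‖ ^ 2 - ‖p (k + 1) - pstar‖ ^ 2 - ‖p (k + 1) - p k‖ ^ 2 :=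
      two_mul_inner_le_of_inner_sub_nonpos
        (by simpa only [← hp k] using (hPi (p k + γ • Θ (u (k + 1)))).2 pstar hpstar)
    have hdual' : 2 * ⟪γ • Θ (u (k + 1)), p (k + 1) - q (k + 1)⟫ ≤
        ‖p (k + 1) - p (k + 1)‖ ^ 2 - ‖q (k + 1) - p (k + 1)‖ ^ 2 -
          ‖q (k + 1) - p (k + 1)‖ ^ 2 :=
      two_mul_inner_le_of_inner_sub_nonpos (by
        simpa only [← hq (k + 1)] using
          (hPi (p (k + 1) + γ • Θ (u (k + 1)))).2 (p (k + 1)) (hpmem k))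
    rw [sub_self, norm_zero] at hdual'
    have hpq : ‖p (k + 1) - q k‖ ≤ γ * (τ * ‖u (k + 1) - u k‖) := by
      have h1 := (hPi (p k + γ • Θ (u (k + 1)))).2 (q k) (hqmem k)
      have h2 := (hPi (p k + γ • Θ (u k))).2 (p (k + 1)) (hpmem k)
      rw [← hp k] at h1
      rw [← hq k] at h2
      refine (norm_sub_le_of_inner_sub_nonpos h1 h2).trans ?_
      rw [add_sub_add_left_eq_sub, ← smul_sub, norm_smul, Real.norm_of_nonneg hγ₁.le]
      exact mul_le_mul_of_nonneg_left (hΘLip _ _) hγ₁.le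
    have hqq : ‖q (k + 1) - q k‖ ≤
        ‖q (k + 1) - p (k + 1)‖ + γ * (τ * ‖u (k + 1) - u k‖) :=
      (norm_sub_le_norm_sub_add_norm_sub _ (p (k + 1)) _).trans (by gcongr)
    have hcross : ⟪q (k + 1) - q k, Θ (u (k + 1)) - Θ (u (k + 2))⟫ ≤
        (‖q (k + 1) - p (k + 1)‖ + γ * (τ * ‖u (k + 1) - u k‖)) *
          (τ * ‖u (k + 2) - u (k + 1)‖) := by
      refine (real_inner_le_norm _ _).trans ?_
      rw [norm_sub_rev (Θ (u (k + 1)))]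
      exact mul_le_mul hqq (hΘLip _ _) (norm_nonneg _) ((norm_nonneg _).trans hqq)
    have hcross' : ⟪G (u (k + 1)) - G (u k), u (k + 1) - u (k + 2)⟫ ≤
        L * ‖u (k + 1) - u k‖ * ‖u (k + 2) - u (k + 1)‖ := by
      refine (real_inner_le_norm _ _).trans ?_
      rw [norm_sub_rev (u (k + 1)) (u (k + 2))]
      exact mul_le_mul_of_nonneg_right (hGLip _ (humem _) _ (humem _)) (norm_nonneg _)
    have hgr := goldenRatio_inner_le hη hη₂ hgold ustar (u (k + 1)) (u (k + 2)) (v (k + 1))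
    rw [← hv (k + 1)] at hgr
    have hanchor : u (k + 1) - v (k + 1) = η • (u (k + 1) - v k) := by
      rw [hv k]
      module
    have hanchor' : ⟪u (k + 1) - v k, u (k + 2) - u (k + 1)⟫ =
        ⟪u (k + 1) - v (k + 1), u (k + 2) - u (k + 1)⟫ / η := by
      rw [hanchor, real_inner_smul_left, mul_div_cancel_left₀ _ hη.ne']
    have hvv : κ * ‖v k - v (k + 1)‖ ^ 2 = ‖u (k + 1) - v (k + 1)‖ ^ 2 / η / (2 * α) := by
      rw [show v k - v (k + 1) = (1 - η) • (v k - u (k + 1)) by rw [hv k]; module, hanchor,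
        norm_smul, norm_smul, norm_sub_rev (v k), Real.norm_of_nonneg hη.le,
        Real.norm_of_nonneg hη'.le, hκ]
      field_simp
    rw [hanchor'] at hopt'
    simp only [d, e, hvv, norm_sub_rev (u k), norm_sub_rev (p k) (p (k + 1))]
    set a := ‖u (k + 1) - u k‖
    set b := ‖u (k + 2) - u (k + 1)‖
    set r := ‖q (k + 1) - p (k + 1)‖
    have hprimal : (⟪u (k + 2) - v (k + 1), ustar - u (k + 2)⟫ +
        ⟪u (k + 1) - v (k + 1), u (k + 2) - u (k + 1)⟫ / η) / α ≤
        ‖v (k + 1) - ustar‖ ^ 2 / (2 * α * (1 - η)) - ‖v (k + 2) - ustar‖ ^ 2 / (2 * α * (1 - η))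
          - ‖u (k + 1) - v (k + 1)‖ ^ 2 / η / (2 * α) - 1 / (2 * α * η) * b ^ 2 := by
      have h := div_le_div_of_nonneg_right hgr (show 0 ≤ 2 * α by positivity)
      rw [mul_div_mul_left _ _ two_ne_zero] at h
      refine h.trans_eq ?_
      field_simp
    have hdualsum : ⟪pstar - q (k + 1), Θ (u (k + 1))⟫ ≤
        ‖p k - pstar‖ ^ 2 / (2 * γ) - ‖p (k + 1) - pstar‖ ^ 2 / (2 * γ) -
          1 / (2 * γ) * ‖p (k + 1) - p k‖ ^ 2 - 1 / γ * r ^ 2 := by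
      have h : 2 * γ * ⟪pstar - q (k + 1), Θ (u (k + 1))⟫ ≤
          ‖p k - pstar‖ ^ 2 - ‖p (k + 1) - pstar‖ ^ 2 - ‖p (k + 1) - p k‖ ^ 2 - 2 * r ^ 2 := by
        rw [real_inner_comm]
        simp only [real_inner_smul_left, inner_sub_right] at hdual hdual' ⊢
        linarith
      rw [← le_div_iff₀' (by positivity)] at h
      refine h.trans_eq ?_
      field_simp
    have hab : (γ * τ ^ 2 + L) * (a * b) ≤ (γ * τ ^ 2 + L) * ((a ^ 2 + b ^ 2) / 2) := by
      gcongr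
      linarith [two_mul_le_add_sq a b]
    have hrb : τ * (r * b) ≤ τ * ((r ^ 2 + b ^ 2) / 2) := by
      gcongr
      linarith [two_mul_le_add_sq r b]
    have hr := mul_le_mul_of_nonneg_right hτγ (sq_nonneg r)
    have hb := mul_le_mul_of_nonneg_right hstep (sq_nonneg b)
    have hsum : 0 ≤ ⟪G (u (k + 1)) - G (u k), u (k + 1) - u (k + 2)⟫ +
        ⟪pstar - q (k + 1), Θ (u (k + 1))⟫ +
        ⟪q (k + 1) - q k, Θ (u (k + 1)) - Θ (u (k + 2))⟫ +
        (⟪u (k + 2) - v (k + 1), ustar - u (k + 2)⟫ +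
          ⟪u (k + 1) - v (k + 1), u (k + 2) - u (k + 1)⟫ / η) / α := by
      rw [real_inner_comm] at hslack
      rw [add_div]
      simp only [add_assoc, Nat.reduceAdd] at hopt hopt'
      simp only [inner_sub_left (𝕜 := ℝ) (pstar), inner_sub_left (𝕜 := ℝ) (q (k + 1)),
        inner_sub_left (𝕜 := ℝ) (G (u (k + 1))),
        inner_sub_right (𝕜 := ℝ) (G _), inner_sub_right (𝕜 := ℝ) pstar,
        inner_sub_right (𝕜 := ℝ) (q _)] at *
      linarith
    simp only [add_assoc, Nat.reduceAdd] at *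
    linarith
  have he : ∀ k, 0 ≤ e k := fun k => by positivity
  have hd : ∀ k, 0 ≤ d k := fun k => by positivity
  have hds : Summable d := summable_of_le_sub_succ hd he hdescent
  set c : ℝ := min κ (min (τ / 2) (1 / (2 * γ)))
  have hc : 0 < c := by positivity
  have hs : Summable fun k => ‖v k - v (k + 1)‖ ^ 2 + ‖u k - u (k + 1)‖ ^ 2 +
      ‖p k - p (k + 1)‖ ^ 2 := by
    refine Summable.of_nonneg_of_le (fun k => by positivity) (fun k => ?_) (hds.mul_left c⁻¹)
    rw [← div_eq_inv_mul, le_div_iff₀' hc, mul_add, mul_add]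
    have h₁ : c ≤ κ := min_le_left _ _
    have h₂ : c ≤ τ / 2 := (min_le_right _ _).trans (min_le_left _ _)
    have h₃ : c ≤ 1 / (2 * γ) := (min_le_right _ _).trans (min_le_right _ _)
    simp only [d]
    gcongr
  refine liminf_sqrt_mul_sqrt_eq_zero (a := fun k => ‖v (k - 1) - v k‖ ^ 2 +
    ‖u (k - 1) - u k‖ ^ 2 + ‖p (k - 1) - p k‖ ^ 2) (fun k => by positivity) ?_
  rw [← summable_nat_add_iff 1]
  simpa only [Nat.add_sub_cancel] using hs
end

section
/- Assume the ALAVI setting with Θ continuously differentiable (and τ-Lipschitz) on ℝⁿ. Then for every k ≥ 1 there exist g ∈ ℝⁿ with J(v) ≥ J(uᵏ) + ⟨g, v − uᵏ⟩ for all v ∈ ℝⁿ (a subgradient of J at uᵏ), ν ∈ ℝⁿ with ⟨ν, ζ − uᵏ⟩ ≤ 0 for all ζ ∈ U (a normal vector to U at uᵏ), and μ ∈ ℝᵐ with ⟨μ, λ − pᵏ⟩ ≤ 0 for all λ ∈ C* (a normal vector to C* at pᵏ), such that ‖G(uᵏ) + g + (DΘ(uᵏ))ᵀ pᵏ + ν‖²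 + ‖−Θ(uᵏ) + μ‖² ≤ σ² ‖wᵏ⁻¹ − wᵏ‖², where σ² = max{3(L + γτ²)², 3/(α²(1−η)²), 3/γ²} and (DΘ(uᵏ))ᵀ is the adjoint of the derivative of Θ at uᵏ. Consequently the distance from 0 to the KKT mapping of (VIP) at (uᵏ, pᵏ) is at most σ‖wᵏ⁻¹ − wᵏ‖. -/
open RealInnerProductSpace

/-- A minimizer of a continuous convex function `h` over a convex set `U` admits a subgradient
of `h` which is nonnegative in all directions pointing into `U`. -/
theorem exists_subgradient_nonneg_of_isMinOn {E : Type*} [NormedAddCommGroup E] [NormedSpace ℝ E]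
    {U : Set E} {h : E → ℝ} {x₀ : E} (hU : Convex ℝ U) (hh : ConvexOn ℝ Set.univ h)
    (hc : Continuous h) (hx₀ : x₀ ∈ U) (hmin : IsMinOn h U x₀) :
    ∃ φ : StrongDual ℝ E, (∀ x, h x₀ + φ (x - x₀) ≤ h x) ∧ ∀ x ∈ U, 0 ≤ φ (x - x₀) := by
  have hopen : IsOpen {z : E × ℝ | z.1 ∈ Set.univ ∧ h z.1 < z.2} := by
    simpa using isOpen_lt (hc.comp continuous_fst) continuous_snd
  have hdisj : Disjoint {z : E × ℝ | z.1 ∈ Set.univ ∧ h z.1 < z.2} (U ×ˢ Set.Iic (h x₀)) := by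
    rw [Set.disjoint_left]
    rintro ⟨x, r⟩ ⟨-, hxr⟩ ⟨hxU, hr⟩
    exact absurd (hmin hxU) (not_le.2 (lt_of_lt_of_le hxr hr))
  obtain ⟨f, s, hlt, hle⟩ := geometric_hahn_banach_open hh.convex_strict_epigraph hopen
    (hU.prod (convex_Iic (h x₀))) hdisj
  set l : StrongDual ℝ E := f.comp (ContinuousLinearMap.inl ℝ E ℝ) with hl
  set β : ℝ := f (0, 1) with hβ
  have hf (x : E) (r : ℝ) : f (x, r) = l x + r * β := by
    have : ((x, r) : E × ℝ) = (x, 0) + r • (0, 1) := by simp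
    rw [this, map_add, map_smul]
    simp [hl, hβ]
  have hepi (x : E) {ε : ℝ} (hε : 0 < ε) : l x + (h x + ε) * β < s := by
    rw [← hf]
    exact hlt _ ⟨trivial, by simpa using hε⟩
  have hmem {x : E} (hx : x ∈ U) : s ≤ l x + h x₀ * β := by
    rw [← hf]
    exact hle _ ⟨hx, Set.self_mem_Iic⟩
  have hβneg : β < 0 := by
    linarith [hepi x₀ one_pos, hmem hx₀]
  have hepi_le (x : E) : l x + h x * β ≤ s := by
    refine le_of_forall_pos_lt_add fun δ hδ ↦ ?_
    have := hepi x (div_pos hδ (neg_pos.2 hβneg))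
    have h2 : δ / -β * β = -δ := by field_simp [hβneg.ne]
    linarith
  refine ⟨(-β)⁻¹ • l, fun x ↦ ?_, fun x hx ↦ ?_⟩
  · have h1 : l (x - x₀) ≤ (h x - h x₀) * (-β) := by
      rw [map_sub]
      linarith [hepi_le x, hmem hx₀]
    have h2 : (-β)⁻¹ * l (x - x₀) ≤ h x - h x₀ := by
      rw [inv_mul_le_iff₀ (neg_pos.2 hβneg)]
      linarith
    simpa using (by linarith : h x₀ + (-β)⁻¹ * l (x - x₀) ≤ h x)
  · have h1 : 0 ≤ l (x - x₀) := by
      rw [map_sub]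
      linarith [hepi_le x₀, hmem hx]
    exact mul_nonneg (inv_nonneg.2 (neg_pos.2 hβneg).le) h1

/-- First-order optimality for the sum of a differentiable and a convex function. -/
theorem IsMinOn.fderiv_add_sub_nonneg {E : Type*} [NormedAddCommGroup E] [NormedSpace ℝ E]
    {U : Set E} {F J : E → ℝ} {F' : StrongDual ℝ E} {x₀ x : E} (hU : Convex ℝ U)
    (hJ : ConvexOn ℝ Set.univ J) (hF : HasFDerivAt F F' x₀)
    (hmin : IsMinOn (fun y ↦ F y + J y) U x₀) (hx₀ : x₀ ∈ U) (hx : x ∈ U) :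
    0 ≤ F' (x - x₀) + (J x - J x₀) := by
  set g : ℝ → ℝ := fun t ↦ F (x₀ + t • (x - x₀)) + t * (J x - J x₀) with hg
  have hderiv : HasDerivAt g (F' (x - x₀) + (J x - J x₀)) 0 := by
    have hline : HasDerivAt (fun t : ℝ ↦ x₀ + t • (x - x₀)) (x - x₀) 0 := by
      simpa using ((hasDerivAt_id (0 : ℝ)).smul_const (x - x₀)).const_add x₀
    have hF0 : HasFDerivAt F F' (x₀ + (0 : ℝ) • (x - x₀)) := by simpa using hF
    refine ((hF0.comp_hasDerivAt 0 hline).add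
      ((hasDerivAt_id (0 : ℝ)).mul_const (J x - J x₀))).congr_deriv ?_
    rw [one_mul]
  have hgmin : IsMinOn g (Set.Icc 0 1) 0 := by
    intro t ht
    have hcomb : x₀ + t • (x - x₀) = (1 - t) • x₀ + t • x := by module
    have hyU : x₀ + t • (x - x₀) ∈ U := by
      rw [hcomb]
      exact hU hx₀ hx (by linarith [ht.2]) ht.1 (by ring)
    have hJle : J (x₀ + t • (x - x₀)) ≤ (1 - t) * J x₀ + t * J x := by
      rw [hcomb]
      exact hJ.2 trivial trivial (by linarith [ht.2]) ht.1 (by ring)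
    have hle : F x₀ + J x₀ ≤ F (x₀ + t • (x - x₀)) + J (x₀ + t • (x - x₀)) := hmin hyU
    simp only [hg, Set.mem_ofPred_eq, zero_smul, add_zero, zero_mul]
    linarith
  have hcone : (1 : ℝ) ∈ posTangentConeAt (Set.Icc (0 : ℝ) 1) 0 := by
    apply mem_posTangentConeAt_of_segment_subset
    rw [zero_add, segment_eq_Icc zero_le_one]
  simpa using hgmin.localize.hasFDerivWithinAt_nonneg
    hderiv.hasFDerivAt.hasFDerivWithinAt hcone

/-- Sum rule at a constrained minimizer: the stationarity condition splits into a subgradient of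
the convex part and a normal vector to the constraint set. -/
theorem exists_subgradient_normal_of_isMinOn {E : Type*} [NormedAddCommGroup E]
    [InnerProductSpace ℝ E] [FiniteDimensional ℝ E] {U : Set E} {F J : E → ℝ} {c x₀ : E}
    (hU : Convex ℝ U) (hJ : ConvexOn ℝ Set.univ J) (hF : HasFDerivAt F (innerSL ℝ c) x₀)
    (hmin : IsMinOn (fun y ↦ F y + J y) U x₀) (hx₀ : x₀ ∈ U) :
    ∃ g ν : E, (∀ x, J x₀ + ⟪g, x - x₀⟫ ≤ J x) ∧ (∀ x ∈ U, ⟪ν, x - x₀⟫ ≤ 0) ∧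
      c + g + ν = 0 := by
  have hlin : IsMinOn (fun y ↦ ⟪c, y⟫ + J y) U x₀ := by
    intro x hx
    have := hmin.fderiv_add_sub_nonneg hU hJ hF hx₀ hx
    rw [innerSL_apply_apply, inner_sub_right] at this
    simp only [Set.mem_ofPred_eq]
    linarith
  obtain ⟨φ, hsub, hpos⟩ := exists_subgradient_nonneg_of_isMinOn hU
    ((innerSL ℝ c).toLinearMap.convexOn convex_univ |>.add hJ)
    ((innerSL ℝ c).continuous.add (hJ.locallyLipschitz.continuous)) hx₀ hlin
  obtain ⟨d, rfl⟩ := (InnerProductSpace.toDual ℝ E).surjective φ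
  simp only [InnerProductSpace.toDual_apply_apply] at hsub hpos
  refine ⟨d - c, -d, fun x ↦ ?_, fun x hx ↦ ?_, by abel⟩
  · have := hsub x
    simp only [Pi.add_apply, ContinuousLinearMap.coe_coe, innerSL_apply_apply] at this
    rw [inner_sub_left, inner_sub_right c]
    linarith
  · rw [inner_neg_left]
    linarith [hpos x hx]

/-- A map satisfying the variational characterization of the projection is nonexpansive. -/
theorem norm_sub_le_of_projection_inequality {E : Type*} [NormedAddCommGroup E]
    [InnerProductSpace ℝ E] {K : Set E} {P : E → E}
    (hP : ∀ x, P x ∈ K ∧ ∀ y ∈ K, ⟪x - P x, y - P x⟫ ≤ 0) (x y : E) :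
    ‖P x - P y‖ ≤ ‖x - y‖ := by
  have h1 := (hP x).2 _ (hP y).1
  have h2 := (hP y).2 _ (hP x).1
  have h3 : ‖P x - P y‖ ^ 2 ≤ ⟪x - y, P x - P y⟫ := by
    rw [← real_inner_self_eq_norm_sq]
    have e : ⟪x - y, P x - P y⟫ - ⟪P x - P y, P x - P y⟫ =
        -⟪x - P x, P y - P x⟫ - ⟪y - P y, P x - P y⟫ := by
      rw [← neg_sub (P x) (P y), inner_neg_right, neg_neg, ← inner_sub_left, ← inner_sub_left]
      congr 1
      abel
    linarith
  have h4 := real_inner_le_norm (x - y) (P x - P y)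
  by_contra! hlt
  nlinarith [norm_nonneg (x - y), norm_nonneg (P x - P y)]

theorem stmt16 (n m : ℕ)
    (U : Set (EuclideanSpace ℝ (Fin n)))
    (hUne : U.Nonempty) (hUcl : IsClosed U) (hUcx : Convex ℝ U)
    (C : Set (EuclideanSpace ℝ (Fin m)))
    (hCne : C.Nonempty) (hCcl : IsClosed C) (hCcx : Convex ℝ C)
    (hCcone : ∀ c ∈ C, ∀ t : ℝ, 0 < t → t • c ∈ C)
    (Cstar : Set (EuclideanSpace ℝ (Fin m)))
    (hCstar : Cstar = {p | ∀ c ∈ C, 0 ≤ ⟪p, c⟫})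
    (G : EuclideanSpace ℝ (Fin n) → EuclideanSpace ℝ (Fin n)) (hG : Continuous G)
    (J : EuclideanSpace ℝ (Fin n) → ℝ) (hJ : ConvexOn ℝ Set.univ J)
    (Θ : EuclideanSpace ℝ (Fin n) → EuclideanSpace ℝ (Fin m)) (hΘc : Continuous Θ)
    (hΘcx : ∀ x y : EuclideanSpace ℝ (Fin n), ∀ a : ℝ, a ∈ Set.Icc (0 : ℝ) 1 →
      Θ (a • x + (1 - a) • y) - a • Θ x - (1 - a) • Θ y ∈ -C)
    (Pi : EuclideanSpace ℝ (Fin m) → EuclideanSpace ℝ (Fin m))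
    (hPi : ∀ x, Pi x ∈ Cstar ∧ ∀ y ∈ Cstar, ⟪x - Pi x, y - Pi x⟫ ≤ 0)
    (L τ η γ α : ℝ) (hL : 0 ≤ L) (hτ : 0 < τ)
    (hGLip : ∀ x ∈ U, ∀ y ∈ U, ‖G x - G y‖ ≤ L * ‖x - y‖)
    (hΘLip : ∀ x y : EuclideanSpace ℝ (Fin n), ‖Θ x - Θ y‖ ≤ τ * ‖x - y‖)
    (hη₁ : (Real.sqrt 5 - 1) / 2 ≤ η) (hη₂ : η < 1)
    (hγ₁ : 0 < γ) (hγ₂ : γ < 1 / τ)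
    (hα₁ : 0 < α) (hα₂ : α ≤ 1 / (2 * (γ * τ ^ 2 + L + τ) * η))
    (u v : ℕ → EuclideanSpace ℝ (Fin n)) (p q : ℕ → EuclideanSpace ℝ (Fin m))
    (hu0 : u 0 ∈ U)
    (hq : ∀ k, q k = Pi (p k + γ • Θ (u k)))
    (huU : ∀ k, u (k + 1) ∈ U)
    (humin : ∀ k, ∀ x ∈ U,
      ⟪G (u k), u (k + 1)⟫ + J (u (k + 1)) + ⟪q k, Θ (u (k + 1))⟫ +
          ‖u (k + 1) - v k‖ ^ 2 / (2 * α) ≤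
        ⟪G (u k), x⟫ + J x + ⟪q k, Θ x⟫ + ‖x - v k‖ ^ 2 / (2 * α))
    (hp : ∀ k, p (k + 1) = Pi (p k + γ • Θ (u (k + 1))))
    (hv : ∀ k, v (k + 1) = (1 - η) • u (k + 1) + η • v k)
    (hΘdiff : ContDiff ℝ 1 Θ)
    (σsq : ℝ)
    (hσsq : σsq = max (3 * (L + γ * τ ^ 2) ^ 2)
      (max (3 / (α ^ 2 * (1 - η) ^ 2)) (3 / γ ^ 2))) :
    ∀ k : ℕ, ∃ g ν : EuclideanSpace ℝ (Fin n), ∃ μ : EuclideanSpace ℝ (Fin m),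
      (∀ x : EuclideanSpace ℝ (Fin n), J (u (k + 1)) + ⟪g, x - u (k + 1)⟫ ≤ J x) ∧
      (∀ ζ ∈ U, ⟪ν, ζ - u (k + 1)⟫ ≤ 0) ∧
      (∀ lam ∈ Cstar, ⟪μ, lam - p (k + 1)⟫ ≤ 0) ∧
      ‖G (u (k + 1)) + g +
          (ContinuousLinearMap.adjoint (fderiv ℝ Θ (u (k + 1)))) (p (k + 1)) + ν‖ ^ 2 +
        ‖-Θ (u (k + 1)) + μ‖ ^ 2 ≤
      σsq * (‖v k - v (k + 1)‖ ^ 2 + ‖u k - u (k + 1)‖ ^ 2 + ‖p k - p (k + 1)‖ ^ 2) := by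
  intro k
  set D := fderiv ℝ Θ (u (k + 1)) with hD
  set A := ContinuousLinearMap.adjoint D with hA
  have hη : 0 < 1 - η := by linarith
  have hDderiv : HasFDerivAt Θ D (u (k + 1)) :=
    (hΘdiff.differentiable one_ne_zero _).hasFDerivAt
  have hAnorm : ‖A‖ ≤ τ := by
    rw [hA, LinearIsometryEquiv.norm_map]
    refine norm_fderiv_le_of_lipschitz ℝ (C := ⟨τ, hτ.le⟩)
      (LipschitzWith.of_dist_le_mul fun x y ↦ ?_)
    rw [dist_eq_norm, dist_eq_norm]
    exact hΘLip x y
  have hF : HasFDerivAt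
      (fun x ↦ ⟪G (u k), x⟫ + ⟪q k, Θ x⟫ + ‖x - v k‖ ^ 2 / (2 * α))
      (innerSL ℝ (G (u k) + A (q k) + α⁻¹ • (u (k + 1) - v k))) (u (k + 1)) := by
    have h1 := (innerSL ℝ (G (u k))).hasFDerivAt (x := u (k + 1))
    have h2 := (innerSL ℝ (q k)).hasFDerivAt.comp (u (k + 1)) hDderiv
    have h3 := (((hasFDerivAt_id (𝕜 := ℝ) (u (k + 1))).sub_const (v k)).norm_sq).mul_const
      (2 * α)⁻¹
    refine ((h1.add h2).add h3).congr_fderiv ?_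
    ext x
    simp [hA, ContinuousLinearMap.adjoint_inner_left]
    field_simp
  obtain ⟨g, ν, hg, hν, hsum⟩ := exists_subgradient_normal_of_isMinOn hUcx hJ hF
    (fun x hx ↦ by
      have := humin k x hx
      simp only [Set.mem_ofPred_eq]
      linarith) (huU k)
  refine ⟨g, ν, γ⁻¹ • (p k + γ • Θ (u (k + 1)) - p (k + 1)), hg, hν, fun lam hlam ↦ ?_, ?_⟩
  · rw [real_inner_smul_left]
    refine mul_nonpos_of_nonneg_of_nonpos (inv_nonneg.2 hγ₁.le) ?_
    rw [hp k]
    exact (hPi _).2 lam hlam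
  have hdual : -Θ (u (k + 1)) + γ⁻¹ • (p k + γ • Θ (u (k + 1)) - p (k + 1)) =
      γ⁻¹ • (p k - p (k + 1)) := by
    rw [smul_sub, smul_add, inv_smul_smul₀ hγ₁.ne', smul_sub]
    abel
  have hvk : α⁻¹ • (u (k + 1) - v k) = -((α * (1 - η))⁻¹ • (v k - v (k + 1))) := by
    have : v k - v (k + 1) = -((1 - η) • (u (k + 1) - v k)) := by
      rw [hv k]
      module
    rw [this, smul_neg, neg_neg, smul_smul, mul_inv, mul_assoc, inv_mul_cancel₀ hη.ne', mul_one]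
  have hprimal : G (u (k + 1)) + g + A (p (k + 1)) + ν =
      (G (u (k + 1)) - G (u k)) + A (p (k + 1) - q k) +
        (α * (1 - η))⁻¹ • (v k - v (k + 1)) := by
    rw [hvk] at hsum
    rw [map_sub, ← sub_eq_zero, ← hsum]
    abel
  have hukU : u k ∈ U := by
    cases k with
    | zero => exact hu0
    | succ k => exact huU k
  have hGle : ‖G (u (k + 1)) - G (u k)‖ ≤ L * ‖u k - u (k + 1)‖ := by
    rw [norm_sub_rev (u k)]
    exact hGLip _ (huU k) _ hukU
  have hpq : ‖p (k + 1) - q k‖ ≤ γ * (τ * ‖u k - u (k + 1)‖) := by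
    rw [hp k, hq k]
    refine (norm_sub_le_of_projection_inequality hPi _ _).trans ?_
    rw [add_sub_add_left_eq_sub, ← smul_sub, norm_smul, Real.norm_of_nonneg hγ₁.le,
      norm_sub_rev (u k)]
    exact mul_le_mul_of_nonneg_left (hΘLip _ _) hγ₁.le
  have hAle : ‖A (p (k + 1) - q k)‖ ≤ τ * (γ * (τ * ‖u k - u (k + 1)‖)) :=
    (A.le_opNorm _).trans (mul_le_mul hAnorm hpq (norm_nonneg _) hτ.le)
  have hnorm : ‖G (u (k + 1)) + g + A (p (k + 1)) + ν‖ ≤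
      (L + γ * τ ^ 2) * ‖u k - u (k + 1)‖ + (α * (1 - η))⁻¹ * ‖v k - v (k + 1)‖ := by
    rw [hprimal]
    refine norm_add₃_le.trans ?_
    rw [norm_smul, Real.norm_of_nonneg (by positivity : 0 ≤ (α * (1 - η))⁻¹)]
    linarith
  have hσ₁ : 3 * (L + γ * τ ^ 2) ^ 2 ≤ σsq := hσsq ▸ le_max_left _ _
  have hσ₂ : 3 * (α * (1 - η))⁻¹ ^ 2 ≤ σsq := by
    have : 3 * (α * (1 - η))⁻¹ ^ 2 = 3 / (α ^ 2 * (1 - η) ^ 2) := by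
      rw [inv_pow, mul_pow, div_eq_mul_inv]
    rw [this, hσsq]
    exact (le_max_left _ _).trans (le_max_right _ _)
  have hσ₃ : 3 * γ⁻¹ ^ 2 ≤ σsq := by
    rw [inv_pow, ← div_eq_mul_inv, hσsq]
    exact (le_max_right _ _).trans (le_max_right _ _)
  have hsq := pow_le_pow_left₀ (norm_nonneg _) hnorm 2
  rw [hdual, norm_smul, Real.norm_of_nonneg (inv_nonneg.2 hγ₁.le), mul_pow]
  have hu2 := mul_le_mul_of_nonneg_right hσ₁ (sq_nonneg ‖u k - u (k + 1)‖)
  have hv2 := mul_le_mul_of_nonneg_right hσ₂ (sq_nonneg ‖v k - v (k + 1)‖)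
  have hp2 := mul_le_mul_of_nonneg_right hσ₃ (sq_nonneg ‖p k - p (k + 1)‖)
  have hab := add_sq_le (a := (L + γ * τ ^ 2) * ‖u k - u (k + 1)‖)
    (b := (α * (1 - η))⁻¹ * ‖v k - v (k + 1)‖)
  rw [mul_pow, mul_pow] at hab
  have hpos₁ : 0 ≤ (L + γ * τ ^ 2) ^ 2 * ‖u k - u (k + 1)‖ ^ 2 := by positivity
  have hpos₂ : 0 ≤ (α * (1 - η))⁻¹ ^ 2 * ‖v k - v (k + 1)‖ ^ 2 := by positivity
  have hpos₃ : 0 ≤ γ⁻¹ ^ 2 * ‖p k - p (k + 1)‖ ^ 2 := by positivity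
  linarith
end

section
/- Let r > 0 and suppose (u⋆, p⋆) ∈ U × C* solves (VIS) with ‖u⋆‖ ≤ r and ‖p⋆‖ ≤ r. Then (ii) ψ(u, p) ≥ 0 for every (u, p) ∈ (U ∩ B_n(r)) × (C* ∩ B_m(r)); and (iii) if moreover (u⋆, p⋆) solves (MVIS), then ψ(u⋆, p⋆) = 0. -/
open RealInnerProductSpace

theorem stmt17 (n m : ℕ)
    (U : Set (EuclideanSpace ℝ (Fin n)))
    (hUne : U.Nonempty) (hUcl : IsClosed U) (hUcx : Convex ℝ U)
    (C : Set (EuclideanSpace ℝ (Fin m)))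
    (hCne : C.Nonempty) (hCcl : IsClosed C) (hCcx : Convex ℝ C)
    (hCcone : ∀ c ∈ C, ∀ t : ℝ, 0 < t → t • c ∈ C)
    (Cstar : Set (EuclideanSpace ℝ (Fin m)))
    (hCstar : Cstar = {p | ∀ c ∈ C, 0 ≤ ⟪p, c⟫})
    (G : EuclideanSpace ℝ (Fin n) → EuclideanSpace ℝ (Fin n)) (hG : Continuous G)
    (J : EuclideanSpace ℝ (Fin n) → ℝ) (hJ : ConvexOn ℝ Set.univ J)
    (Θ : EuclideanSpace ℝ (Fin n) → EuclideanSpace ℝ (Fin m)) (hΘc : Continuous Θ)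
    (r : ℝ) (hr : 0 < r)
    (ψ : EuclideanSpace ℝ (Fin n) → EuclideanSpace ℝ (Fin m) → ℝ)
    (hψ : ∀ x y, ψ x y = sSup {t : ℝ |
      ∃ ζ ∈ U ∩ Metric.closedBall 0 r, ∃ lam ∈ Cstar ∩ Metric.closedBall 0 r,
        t = ⟪G ζ, x - ζ⟫ + J x - J ζ + ⟪lam, Θ x⟫ - ⟪y, Θ ζ⟫})
    (ustar : EuclideanSpace ℝ (Fin n)) (hustar : ustar ∈ U) (hur : ‖ustar‖ ≤ r)
    (pstar : EuclideanSpace ℝ (Fin m)) (hpstar : pstar ∈ Cstar) (hpr : ‖pstar‖ ≤ r)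
    (hVIS1 : ∀ x ∈ U, 0 ≤ ⟪G ustar, x - ustar⟫ + J x - J ustar + ⟪pstar, Θ x - Θ ustar⟫)
    (hVIS2 : ∀ y ∈ Cstar, ⟪Θ ustar, y - pstar⟫ ≤ 0) :
    (∀ x ∈ U ∩ Metric.closedBall 0 r, ∀ y ∈ Cstar ∩ Metric.closedBall 0 r,
      0 ≤ ψ x y) ∧
    ((∀ x ∈ U, 0 ≤ ⟪G x, x - ustar⟫ + J x - J ustar + ⟪pstar, Θ x - Θ ustar⟫) →
      ψ ustar pstar = 0) := by
  have hJc : Continuous J :=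
    continuousOn_univ.1 (hJ.continuousOn isOpen_univ)
  have hbdd : ∀ x y, BddAbove {t : ℝ |
      ∃ ζ ∈ U ∩ Metric.closedBall 0 r, ∃ lam ∈ Cstar ∩ Metric.closedBall 0 r,
        t = ⟪G ζ, x - ζ⟫ + J x - J ζ + ⟪lam, Θ x⟫ - ⟪y, Θ ζ⟫} := by
    intro x y
    have hcont : Continuous fun q : EuclideanSpace ℝ (Fin n) × EuclideanSpace ℝ (Fin m) =>
        ⟪G q.1, x - q.1⟫ + J x - J q.1 + ⟪q.2, Θ x⟫ - ⟪y, Θ q.1⟫ := by fun_prop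
    have hcompact := (isCompact_closedBall (0 : EuclideanSpace ℝ (Fin n)) r).prod
      (isCompact_closedBall (0 : EuclideanSpace ℝ (Fin m)) r)
    refine (hcompact.image hcont).bddAbove.mono ?_
    rintro t ⟨ζ, hζ, lam, hlam, rfl⟩
    exact ⟨(ζ, lam), ⟨hζ.2, hlam.2⟩, rfl⟩
  have hnonneg : ∀ x ∈ U ∩ Metric.closedBall 0 r, ∀ y ∈ Cstar ∩ Metric.closedBall 0 r,
      0 ≤ ψ x y := by
    intro x hx y hy
    rw [hψ]
    exact le_csSup (hbdd x y) ⟨x, hx, y, hy, by simp⟩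
  refine ⟨hnonneg, fun hM => le_antisymm ?_ ?_⟩
  · rw [hψ]
    refine Real.sSup_le ?_ le_rfl
    rintro t ⟨ζ, hζ, lam, hlam, rfl⟩
    have h₁ := hM ζ hζ.1
    have h₂ := hVIS2 lam hlam.1
    rw [← neg_sub ustar ζ, inner_neg_right, inner_sub_right pstar] at h₁
    rw [inner_sub_right, real_inner_comm lam, real_inner_comm pstar] at h₂
    linarith
  · exact hnonneg ustar ⟨hustar, by simpa using hur⟩ pstar ⟨hpstar, by simpa using hpr⟩
end

section
/- Let r > 0 and suppose (û, p̂) ∈ (U ∩ B_n(r)) × (C* ∩ B_m(r)) satisfies Ψ(û, p̂, ζ, λ) ≤ 0 for all (ζ, λ) ∈ (U ∩ B_n(r)) × (C* ∩ B_m(r)) (equivalently ψ(û, p̂) ≤ 0). Then ⟨G(û), ζ − û⟩ + J(ζ) − J(û) + ⟨p̂, Θ(ζ) − Θ(û)⟩ ≥ 0 for every ζ ∈ U ∩ B_n(r), and ⟨p̂ − λ, Θ(û)⟩ ≥ 0 for every λ ∈ C* ∩ B_m(r); that is, (û, p̂) is a KKT point of (VIP) relative to the truncated sets. -/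
open RealInnerProductSpace

theorem stmt18 (n m : ℕ)
    (U : Set (EuclideanSpace ℝ (Fin n)))
    (hUne : U.Nonempty) (hUcl : IsClosed U) (hUcx : Convex ℝ U)
    (C : Set (EuclideanSpace ℝ (Fin m)))
    (hCne : C.Nonempty) (hCcl : IsClosed C) (hCcx : Convex ℝ C)
    (hCcone : ∀ c ∈ C, ∀ t : ℝ, 0 < t → t • c ∈ C)
    (Cstar : Set (EuclideanSpace ℝ (Fin m)))
    (hCstar : Cstar = {p | ∀ c ∈ C, 0 ≤ ⟪p, c⟫})
    (G : EuclideanSpace ℝ (Fin n) → EuclideanSpace ℝ (Fin n)) (hG : Continuous G)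
    (J : EuclideanSpace ℝ (Fin n) → ℝ) (hJ : ConvexOn ℝ Set.univ J)
    (Θ : EuclideanSpace ℝ (Fin n) → EuclideanSpace ℝ (Fin m)) (hΘc : Continuous Θ)
    (hΘcx : ∀ x y : EuclideanSpace ℝ (Fin n), ∀ a : ℝ, a ∈ Set.Icc (0 : ℝ) 1 →
      Θ (a • x + (1 - a) • y) - a • Θ x - (1 - a) • Θ y ∈ -C)
    (r : ℝ) (hr : 0 < r)
    (uhat : EuclideanSpace ℝ (Fin n)) (hu : uhat ∈ U ∩ Metric.closedBall 0 r)
    (phat : EuclideanSpace ℝ (Fin m)) (hp : phat ∈ Cstar ∩ Metric.closedBall 0 r)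
    (hΨ : ∀ ζ ∈ U ∩ Metric.closedBall 0 r, ∀ lam ∈ Cstar ∩ Metric.closedBall 0 r,
      ⟪G ζ, uhat - ζ⟫ + J uhat - J ζ + ⟪lam, Θ uhat⟫ - ⟪phat, Θ ζ⟫ ≤ 0) :
    (∀ ζ ∈ U ∩ Metric.closedBall 0 r,
      0 ≤ ⟪G uhat, ζ - uhat⟫ + J ζ - J uhat + ⟪phat, Θ ζ - Θ uhat⟫) ∧
    (∀ lam ∈ Cstar ∩ Metric.closedBall 0 r, 0 ≤ ⟪phat - lam, Θ uhat⟫) := by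
  subst hCstar
  have hmem : ∀ x, x ∈ -C → 0 ≤ ⟪phat, -x⟫ := fun x hx => hp.1 _ hx
  refine ⟨fun ζ hζ => ?_, fun lam hlam => ?_⟩
  · have hball : Convex ℝ (U ∩ Metric.closedBall 0 r) :=
      hUcx.inter (convex_closedBall 0 r)
    have key : ∀ t ∈ Set.Ioc (0 : ℝ) 1,
        0 ≤ ⟪G (t • ζ + (1 - t) • uhat), ζ - uhat⟫ + J ζ - J uhat + ⟪phat, Θ ζ - Θ uhat⟫ := by
      intro t ht
      have ht1 : 0 ≤ 1 - t := by linarith [ht.2]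
      have h1 := hΨ _ (hball hζ hu ht.1.le ht1 (by ring)) phat hp
      have h2 := hJ.2 (Set.mem_univ ζ) (Set.mem_univ uhat) ht.1.le ht1 (by ring)
      have h3 := hmem _ (hΘcx ζ uhat t ⟨ht.1.le, ht.2⟩)
      have h4 : uhat - (t • ζ + (1 - t) • uhat) = -(t • (ζ - uhat)) := by module
      rw [h4] at h1
      simp only [inner_neg_right, inner_smul_right, inner_sub_right, smul_eq_mul] at h1 h2 h3 ⊢
      refine nonneg_of_mul_nonneg_right ?_ ht.1
      linarith
    have hcont : Continuous fun t : ℝ =>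
        ⟪G (t • ζ + (1 - t) • uhat), ζ - uhat⟫ + J ζ - J uhat + ⟪phat, Θ ζ - Θ uhat⟫ := by
      fun_prop
    have hlim := (hcont.tendsto 0).mono_left (nhdsWithin_le_nhds (s := Set.Ioi 0))
    simp only [zero_smul, sub_zero, one_smul, zero_add] at hlim
    exact ge_of_tendsto hlim
      (Filter.mem_of_superset (Ioc_mem_nhdsGT one_pos) key)
  · have h := hΨ uhat hu lam hlam
    rw [sub_self, inner_zero_right] at h
    rw [inner_sub_left]
    linarith
end
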